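/- arXiv:1910.11145 — 3 statements merged into one kernel-verified Lean document; each statement's English description precedes it below -/
import Mathlib

section
/- Let p be a prime and let G be a finite nonabelian p-group whose automorphism group Aut(G) is abelian. If the commutator subgroup G' of G has order greater than 2, then G' is not cyclic. -/
/-- `maol G` is the maximum length of an orbit of the natural action of `Aut(G)` on `G`. -/
noncomputable def maol (G : Type*) [Group G] : ℕ :=
  ⨆ g : G, Nat.card (MulAction.orbit (MulAut G) g)

open scoped commutatorElement

open CommGroup in
/-- A character of a finite abelian group is an `m`-th power if it kills the `m`-torsion. -/
theorem CommGroup.exists_pow_eq_of_forall_pow_eq_one {A : Type*} [CommGroup A] [Finite A]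
    (m : ℕ) (χ : A →* ℂˣ) (h : ∀ x, x ^ m = 1 → χ x = 1) : ∃ l : A →* ℂˣ, ∀ x, l x ^ m = χ x := by
  let Φ : Subgroup (A →* ℂˣ) :=
    (MonoidHom.mk' (fun φ : A →* ℂˣ ↦ φ ^ m) fun φ ψ ↦ mul_pow φ ψ m).range
  have : χ ∈ Φ := by
    have key := mem_subgroupOrderIsoSubgroupMonoidHom_iff ℂ
      ((subgroupOrderIsoSubgroupMonoidHom A ℂ).symm (OrderDual.toDual Φ)) χ
    rw [OrderIso.apply_symm_apply] at key
    refine key.2 fun g hg ↦ h g ?_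
    rw [mem_subgroupOrderIsoSubgroupMonoidHom_symm_iff] at hg
    refine (forall_apply_eq_apply_iff A (M := ℂ)).1 fun φ ↦ ?_
    simpa using hg (φ ^ m) ⟨φ, rfl⟩
  obtain ⟨l, hl⟩ := this
  exact ⟨l, fun x ↦ DFunLike.congr_fun hl x⟩

/-- A homomorphism from `G` to a cyclic group `⟨ζ⟩` of order `p` lifts to a homomorphism to
`ZMod (p ^ (M + 1))`, here given by natural number representatives, if it kills the elements of
order dividing `p ^ M` modulo the commutator subgroup. -/
theorem exists_exponent_lift {p : ℕ} (hp : p.Prime) {G : Type*} [Group G] [Finite G]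
    {H : Type*} [Group H] {ζ : H} (hζ : orderOf ζ = p) (hgen : ∀ x, x ∈ Subgroup.zpowers ζ)
    (M : ℕ) (f : G →* H) (hf : ∀ g, g ^ p ^ M ∈ commutator G → f g = 1) :
    ∃ κ : G → ℕ, (∀ g h, κ (g * h) ≡ κ g + κ h [MOD p ^ (M + 1)]) ∧
      (∀ g ∈ commutator G, κ g ≡ 0 [MOD p ^ (M + 1)]) ∧ ∀ g, f g = ζ ^ κ g := by
  have hpN : p ^ (M + 1) ≠ 0 := pow_ne_zero _ hp.ne_zero
  have : NeZero (p ^ (M + 1)) := ⟨hpN⟩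
  obtain ⟨η₀, hη₀⟩ := HasEnoughRootsOfUnity.exists_primitiveRoot ℂ (p ^ (M + 1))
  obtain ⟨η, rfl⟩ := hη₀.isUnit hpN
  have hη : IsPrimitiveRoot η (p ^ (M + 1)) := IsPrimitiveRoot.coe_units_iff.1 hη₀
  have hω : IsPrimitiveRoot (η ^ p ^ M) p := hη.pow hpN.bot_lt (pow_succ p M)
  have hdvd : orderOf (η ^ p ^ M) ∣ orderOf ζ := by rw [← hω.eq_orderOf, hζ]
  let ψ : H →* ℂˣ := monoidHomOfForallMemZpowers hgen hdvd
  have hψ : ψ ζ = η ^ p ^ M := monoidHomOfForallMemZpowers_apply_gen hgen hdvd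
  let χ : Abelianization G →* ℂˣ := Abelianization.lift (ψ.comp f)
  obtain ⟨l, hl⟩ := CommGroup.exists_pow_eq_of_forall_pow_eq_one (p ^ M) χ (by
    intro x
    induction x using QuotientGroup.induction_on with
    | H g =>
      intro hg
      have : g ^ p ^ M ∈ commutator G := by
        exact (QuotientGroup.eq_one_iff _).1 hg
      have h1 : χ (Abelianization.of g) = ψ (f g) := by simp [χ]
      exact h1.trans (by simp [hf g this]))
  have hl' (g : G) : l (Abelianization.of g) ^ p ^ M = ψ (f g) := by
    rw [hl]; simp [χ]
  have hfp (x : H) : x ^ p = 1 := by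
    obtain ⟨i, rfl⟩ := hgen x
    change (ζ ^ i) ^ p = 1
    rw [← zpow_natCast, zpow_comm, zpow_natCast, ← hζ, pow_orderOf_eq_one, one_zpow]
  have hroot (g : G) : l (Abelianization.of g) ^ p ^ (M + 1) = 1 := by
    rw [pow_succ, pow_mul, hl', ← map_pow, hfp, map_one]
  have hex (g : G) : ∃ i, η ^ i = l (Abelianization.of g) := by
    obtain ⟨i, -, hi⟩ := hη₀.eq_pow_of_pow_eq_one (ξ := (l (Abelianization.of g) : ℂ))
      (by rw [← Units.val_pow_eq_pow_val, hroot, Units.val_one])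
    exact ⟨i, Units.ext (by simpa using hi)⟩
  choose κ hκ using hex
  have hmod {i j : ℕ} : η ^ i = η ^ j ↔ i ≡ j [MOD p ^ (M + 1)] := by
    rw [pow_eq_pow_iff_modEq, ← hη.eq_orderOf]
  refine ⟨κ, fun g h ↦ hmod.1 ?_, fun g hg ↦ hmod.1 ?_, fun g ↦ ?_⟩
  · rw [pow_add, hκ, hκ, hκ, map_mul, map_mul]
  · rw [hκ, pow_zero]
    have : Abelianization.of g = 1 := (QuotientGroup.eq_one_iff g).2 hg
    rw [this, map_one]
  · have hfin : IsOfFinOrder ζ := orderOf_pos_iff.1 (by rw [hζ]; exact hp.pos)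
    obtain ⟨i, hi⟩ := hfin.mem_powers_iff_mem_zpowers.2 (hgen (f g))
    change ζ ^ i = f g at hi
    rw [← hi, pow_eq_pow_iff_modEq, hζ, hω.eq_orderOf, ← pow_eq_pow_iff_modEq, ← hψ,
      ← map_pow, hi, ← hl', hψ, ← hκ, ← pow_mul, ← pow_mul, mul_comm]

section ClassTwo

variable {G : Type*} [Group G] (hZ : ∀ a b : G, ⁅a, b⁆ ∈ Subgroup.center G)
include hZ

theorem commutatorElement_mul_left_of_mem_center (a b c : G) :
    ⁅a * b, c⁆ = ⁅a, c⁆ * ⁅b, c⁆ := by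
  rw [commutatorElement_mul_left_eq_conj_mul,
    Subgroup.mem_center_iff.1 (hZ b c) a, mul_inv_cancel_right,
    Subgroup.mem_center_iff.1 (hZ b c)]

theorem commutatorElement_pow_left_of_mem_center (a b : G) (n : ℕ) :
    ⁅a ^ n, b⁆ = ⁅a, b⁆ ^ n := by
  induction n with
  | zero => simp
  | succ n ih => rw [pow_succ, pow_succ, commutatorElement_mul_left_of_mem_center hZ, ih]

theorem commutatorElement_mul_right_of_mem_center (a b c : G) :
    ⁅a, b * c⁆ = ⁅a, b⁆ * ⁅a, c⁆ := by
  rw [← commutatorElement_inv, commutatorElement_mul_left_of_mem_center hZ, mul_inv_rev,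
    commutatorElement_inv, commutatorElement_inv, Subgroup.mem_center_iff.1 (hZ a b)]

theorem pow_mul_comm_of_commutatorElement_mem_center (a b : G) (n : ℕ) :
    a ^ n * b = b * a ^ n * ⁅a, b⁆ ^ n := by
  have h1 : a ^ n * b = ⁅a ^ n, b⁆ * (b * a ^ n) := by rw [commutatorElement_def]; group
  rw [h1, commutatorElement_pow_left_of_mem_center hZ,
    Subgroup.mem_center_iff.1 (pow_mem (hZ a b) n)]

theorem mul_pow_of_commutatorElement_mem_center (a b : G) (n : ℕ) :
    (a * b) ^ n = a ^ n * b ^ n * ⁅b, a⁆ ^ n.choose 2 := by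
  induction n with
  | zero => simp
  | succ n ih =>
    have hc (i : ℕ) (g : G) : g * ⁅b, a⁆ ^ i = ⁅b, a⁆ ^ i * g :=
      Subgroup.mem_center_iff.1 (pow_mem (hZ b a) i) g
    have h2 : (n + 1).choose 2 = n + n.choose 2 := by simp [Nat.choose_succ_succ]
    have key := pow_mul_comm_of_commutatorElement_mem_center hZ b a n
    calc (a * b) ^ (n + 1) = a ^ n * b ^ n * (⁅b, a⁆ ^ n.choose 2 * (a * b)) := by
          rw [pow_succ, ih, mul_assoc]
      _ = a ^ n * (b ^ n * a) * b * ⁅b, a⁆ ^ n.choose 2 := by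
          rw [← hc]; simp only [mul_assoc]
      _ = a ^ n * a * b ^ n * (⁅b, a⁆ ^ n * b) * ⁅b, a⁆ ^ n.choose 2 := by
          rw [key]; simp only [mul_assoc]
      _ = _ := by rw [← hc n b, h2, pow_add ⁅b, a⁆, pow_succ, pow_succ]; simp only [mul_assoc]

end ClassTwo

theorem Nat.choose_two_add (i j : ℕ) : (i + j).choose 2 = i.choose 2 + j.choose 2 + i * j := by
  induction j with
  | zero => simp
  | succ j ih =>
    have h (n : ℕ) : (n + 1).choose 2 = n + n.choose 2 := by simp [Nat.choose_succ_succ]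
    rw [← add_assoc, h, h, ih]; ring

/-- In a finite group of class two, the map `g ↦ g * y ^ κ g * ζ ^ (κ g).choose 2` is an
automorphism which does not commute with some inner automorphism. -/
theorem exists_mulAut_not_commute {p : ℕ} (hp : p.Prime) {G : Type*} [Group G] [Finite G]
    (hZ : ∀ a b : G, ⁅a, b⁆ ∈ Subgroup.center G) {y ζ : G} (hζ : orderOf ζ = p)
    (hζZ : ζ ∈ Subgroup.center G) {N : ℕ} (hN : p ∣ (p ^ N).choose 2) (hyN : y ^ p ^ N = 1)
    (hy : y ∉ Subgroup.center G) {κ : G → ℕ}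
    (hκ : ∀ g h, κ (g * h) ≡ κ g + κ h [MOD p ^ N]) (hκζ : κ ζ ≡ 0 [MOD p ^ N])
    (hyκ : ∀ g, ⁅y, g⁆ = ζ ^ κ g) :
    ∃ φ ψ : MulAut G, φ * ψ ≠ ψ * φ := by
  have hζ1 {i : ℕ} : ζ ^ i = 1 ↔ p ∣ i := by rw [← hζ, orderOf_dvd_iff_pow_eq_one]
  have hc (i : ℕ) (g : G) : g * ζ ^ i = ζ ^ i * g :=
    Subgroup.mem_center_iff.1 (pow_mem hζZ i) g
  let F : ℕ → G := fun i ↦ y ^ i * ζ ^ i.choose 2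
  have hF (i j : ℕ) : F (i + j) = F i * F j * ζ ^ (i * j) := by
    simp only [F, Nat.choose_two_add, pow_add]
    rw [mul_assoc (y ^ i) (ζ ^ i.choose 2), ← mul_assoc (ζ ^ i.choose 2) (y ^ j),
      ← hc _ (y ^ j)]
    simp only [mul_assoc]
  have hpN : p ∣ p ^ N := by
    refine dvd_pow_self p fun h0 ↦ hy ?_
    simp only [h0, pow_zero, pow_one] at hyN
    exact hyN ▸ one_mem _
  have hFN : F (p ^ N) = 1 := by simp [F, hyN, hζ1.2 hN]
  have hFper (i k : ℕ) : F (i + p ^ N * k) = F i := by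
    induction k with
    | zero => simp
    | succ k ih =>
      rw [mul_add, mul_one, ← add_assoc, hF, ih, hFN, mul_one, hζ1.2 (hpN.mul_left _), mul_one]
  have hFmod {i j : ℕ} (h : i ≡ j [MOD p ^ N]) : F i = F j := by
    rw [← Nat.mod_add_div i (p ^ N), ← Nat.mod_add_div j (p ^ N), hFper, hFper, h]
  have hFh (i : ℕ) (h : G) : F i * h = h * F i * ζ ^ (i * κ h) := by
    have := pow_mul_comm_of_commutatorElement_mem_center hZ y h i
    simp only [F]
    rw [mul_assoc, ← hc, ← mul_assoc, this, hyκ, ← pow_mul, mul_comm (κ h)]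
    rw [mul_assoc, ← pow_add, add_comm, pow_add]; group
  let φ : G →* G := MonoidHom.mk' (fun g ↦ g * F (κ g)) (by
    intro g h
    rw [hFmod (hκ g h), hF, mul_assoc g (F (κ g)), ← mul_assoc (F (κ g)) h, hFh (κ g) h,
      mul_assoc (h * _), ← hc]
    simp only [mul_assoc])
  have hφ (g : G) : φ g = g * F (κ g) := rfl
  let K : G →* Multiplicative (ZMod (p ^ N)) :=
    MonoidHom.mk' (fun g ↦ Multiplicative.ofAdd (κ g : ZMod (p ^ N))) (by
      intro g h
      rw [← ofAdd_add, ← Nat.cast_add, (ZMod.natCast_eq_natCast_iff _ _ _).2 (hκ g h)])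
  have hK (g : G) : (K g).toAdd = (κ g : ZMod (p ^ N)) := rfl
  have hKζ : K ζ = 1 := Multiplicative.toAdd.injective <| by
    rw [hK, (ZMod.natCast_eq_natCast_iff _ _ _).2 hκζ]; simp
  have hinj : Function.Injective φ := by
    rw [injective_iff_map_eq_one]
    intro g hg
    have h1 : K g * K y ^ κ g = 1 := by
      have := congrArg K hg
      simpa [hφ, F, hKζ] using this
    have h2 : ((κ g * (1 + κ y) : ℕ) : ZMod (p ^ N)) = 0 := by
      have := congrArg Multiplicative.toAdd h1
      rw [toAdd_mul, toAdd_pow, hK, hK, toAdd_one, nsmul_eq_mul] at this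
      push_cast
      rw [← this]; ring
    rw [ZMod.natCast_eq_zero_iff] at h2
    have hpy : p ∣ κ y := by rw [← hζ1, ← hyκ, commutatorElement_self]
    have hcop : Nat.Coprime (p ^ N) (1 + κ y) := by
      refine Nat.Coprime.pow_left N ((Nat.Prime.coprime_iff_not_dvd hp).2 fun h ↦ ?_)
      exact hp.one_lt.ne' (Nat.dvd_one.1 ((Nat.dvd_add_left hpy).1 h))
    have h3 : F (κ g) = F 0 := hFmod ((Nat.modEq_zero_iff_dvd).2 (hcop.dvd_of_dvd_mul_right h2))
    rw [hφ, h3] at hg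
    simpa [F] using hg
  let Ψ : MulAut G := MulEquiv.ofBijective φ (Finite.injective_iff_bijective.1 hinj)
  by_contra! hcomm
  have hcen (g h : G) : h * y ^ κ g = y ^ κ g * h := by
    obtain ⟨x, hx⟩ := Ψ.surjective h
    have h1 : Ψ (g * x * g⁻¹) = g * Ψ x * g⁻¹ := DFunLike.congr_fun (hcomm Ψ (MulAut.conj g)) x
    rw [map_mul, map_mul, map_inv, hx] at h1
    change g * F (κ g) * h * (g * F (κ g))⁻¹ = g * h * g⁻¹ at h1
    have h2 : F (κ g) * h = h * F (κ g) := by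
      rw [mul_inv_rev, ← mul_assoc] at h1
      have := mul_right_cancel h1
      rwa [mul_assoc, mul_assoc, mul_right_inj, ← mul_assoc, mul_inv_eq_iff_eq_mul] at this
    simp only [F] at h2
    rw [mul_assoc, ← hc, ← mul_assoc, ← mul_assoc] at h2
    exact (mul_right_cancel h2).symm
  obtain ⟨h, hh⟩ : ∃ h : G, ⁅y, h⁆ ≠ 1 := by
    by_contra! H
    exact hy (Subgroup.mem_center_iff.2 fun g ↦ (commutatorElement_eq_one_iff_mul_comm.1 (H g)).symm)
  have h4 : ⁅y ^ κ h, h⁆ = 1 := commutatorElement_eq_one_iff_mul_comm.2 (hcen h h).symm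
  rw [commutatorElement_pow_left_of_mem_center hZ, hyκ, ← pow_mul, hζ1] at h4
  rw [hyκ, ne_eq, hζ1] at hh
  exact hh ((hp.dvd_mul.1 h4).elim id id)

/-- A finite `p`-group of class two with cyclic commutator subgroup of order `p ^ (k + 1) > 2`
contains an element `a` with noncentral `p ^ k`-th power `y`, and `M` with `y ^ p ^ (M + 1) = 1`,
such that `y` commutes with every element of order dividing `p ^ M` modulo the commutator
subgroup. -/
theorem exists_commutator_pow_ne_one {p : ℕ} (hp : p.Prime) {G : Type*} [Group G] [Finite G]
    (hpG : IsPGroup p G) (hZ : ∀ a b : G, ⁅a, b⁆ ∈ Subgroup.center G) {k : ℕ}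
    (h2 : 2 < p ^ (k + 1)) (hexp : ∀ x ∈ commutator G, x ^ p ^ (k + 1) = 1)
    (hgen : ∀ x ∈ commutator G, x ^ p ^ k ≠ 1 → ∀ w ∈ commutator G, ∃ m : ℕ, x ^ m = w)
    (hne : ∃ a b : G, ⁅a, b⁆ ^ p ^ k ≠ 1) :
    ∃ (a b : G) (M : ℕ), k ≤ M ∧ ⁅a, b⁆ ^ p ^ k ≠ 1 ∧ (a ^ p ^ k) ^ p ^ (M + 1) = 1 ∧
      ∀ h : G, h ^ p ^ M ∈ commutator G → ⁅a, h⁆ ^ p ^ k = 1 := by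
  classical
  have hmem (a b : G) : ⁅a, b⁆ ∈ commutator G :=
    Subgroup.commutator_mem_commutator (Subgroup.mem_top a) (Subgroup.mem_top b)
  have hcen {x : G} (hx : x ∈ commutator G) : x ∈ Subgroup.center G :=
    Subgroup.commutator_le.2 (fun a _ b _ ↦ hZ a b) hx
  have hP : ∃ e : ℕ, ∃ a b : G, ⁅a, b⁆ ^ p ^ k ≠ 1 ∧ a ^ p ^ e ∈ commutator G := by
    obtain ⟨a, b, hab⟩ := hne
    obtain ⟨e, he⟩ := hpG a
    exact ⟨e, a, b, hab, he ▸ one_mem _⟩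
  have hmin (h a : G) {e : ℕ} (he : e < Nat.find hP) (hh : h ^ p ^ e ∈ commutator G) :
      ⁅a, h⁆ ^ p ^ k = 1 := by
    by_contra hcon
    refine Nat.find_min hP he ⟨h, a, fun h1 ↦ hcon ?_, hh⟩
    rw [← commutatorElement_inv, inv_pow, h1, inv_one]
  obtain ⟨a, b, hab, ha⟩ := Nat.find_spec hP
  set e := Nat.find hP
  have hke : k + 1 ≤ e := by
    have h1 : ⁅a, b⁆ ^ p ^ e = 1 := by
      rw [← commutatorElement_pow_left_of_mem_center hZ, commutatorElement_eq_one_iff_mul_comm,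
        Subgroup.mem_center_iff.1 (hcen ha)]
    have : Fact p.Prime := ⟨hp⟩
    rwa [← orderOf_dvd_iff_pow_eq_one, orderOf_eq_prime_pow hab (hexp _ (hmem a b)),
      Nat.pow_dvd_pow_iff_le_right hp.one_lt] at h1
  by_cases hcase : ∃ a b : G, ⁅a, b⁆ ^ p ^ k ≠ 1 ∧ (a ^ p ^ e) ^ p ^ k = 1
  · obtain ⟨a, b, hab, ha⟩ := hcase
    refine ⟨a, b, e - 1, by lia, hab, ?_, fun h hh ↦ hmin h a (by lia) hh⟩
    rw [Nat.sub_add_cancel (by lia), ← pow_mul, mul_comm, pow_mul, ha]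
  · push Not at hcase
    refine ⟨a, b, e, by lia, hab, ?_, fun h hh ↦ ?_⟩
    · rw [← pow_mul, mul_comm, pow_succ, mul_assoc, ← pow_succ', pow_mul, hexp _ ha]
    · by_contra hah
      obtain ⟨m, hm⟩ := hgen _ ha (hcase a b hab) _ (inv_mem hh)
      have h1 : ⁅a, h * a ^ m⁆ = ⁅a, h⁆ := by
        rw [commutatorElement_mul_right_of_mem_center hZ,
          commutatorElement_eq_one_iff_mul_comm.2 (pow_mul_comm' a m).symm, mul_one]
      refine hcase (h * a ^ m) a (fun h3 ↦ hah ?_) ?_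
      · rw [← h1, ← commutatorElement_inv, inv_pow, h3, inv_one]
      · have hle : p ^ (k + 1) ≤ p ^ e := Nat.pow_le_pow_right hp.pos hke
        obtain ⟨d, hd⟩ := hp.dvd_choose_pow (n := e) (k := 2) two_ne_zero (by lia)
        rw [mul_pow_of_commutatorElement_mem_center hZ, ← pow_mul a, mul_comm m, pow_mul, hm,
          mul_inv_cancel, one_mul, hd, ← pow_mul, mul_right_comm, ← pow_succ', pow_mul,
          hexp _ (hmem _ _), one_pow]

theorem stmt_8 (p : ℕ) (hp : p.Prime) (G : Type*) [Group G] [Finite G]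
    (hpG : IsPGroup p G) (hna : ¬ ∀ a b : G, a * b = b * a)
    (haut : ∀ φ ψ : MulAut G, φ * ψ = ψ * φ)
    (hcard : 2 < Nat.card (commutator G)) :
    ¬ IsCyclic (commutator G) := by
  intro hcyc
  have : Fact p.Prime := ⟨hp⟩
  have hZ (a b : G) : ⁅a, b⁆ ∈ Subgroup.center G := by
    refine Subgroup.mem_center_iff.2 fun g ↦ ?_
    have h1 : MulAut.conj ⁅a, b⁆ = 1 := by
      rw [map_commutatorElement, commutatorElement_eq_one_iff_mul_comm, haut]
    have h2 : ⁅a, b⁆ * g * ⁅a, b⁆⁻¹ = g := DFunLike.congr_fun h1 g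
    exact (mul_inv_eq_iff_eq_mul.1 h2).symm
  have hmem (a b : G) : ⁅a, b⁆ ∈ commutator G :=
    Subgroup.commutator_mem_commutator (Subgroup.mem_top a) (Subgroup.mem_top b)
  have hcen {x : G} (hx : x ∈ commutator G) : x ∈ Subgroup.center G :=
    Subgroup.commutator_le.2 (fun a _ b _ ↦ hZ a b) hx
  obtain ⟨n, hn⟩ := (IsPGroup.iff_card (G := commutator G)).1 (hpG.to_subgroup _)
  obtain _ | k := n
  · simp [hn] at hcard
  rw [hn] at hcard
  have hexp (x : G) (hx : x ∈ commutator G) : x ^ p ^ (k + 1) = 1 := by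
    rw [← hn]
    exact congrArg Subtype.val (pow_card_eq_one' (x := (⟨x, hx⟩ : commutator G)))
  have hgen (x : G) (hx : x ∈ commutator G) (hxk : x ^ p ^ k ≠ 1) (w : G)
      (hw : w ∈ commutator G) : ∃ m : ℕ, x ^ m = w := by
    have h1 : Subgroup.zpowers x = commutator G := by
      refine Subgroup.eq_of_le_of_card_ge (Subgroup.zpowers_le.2 hx) ?_
      rw [Nat.card_zpowers, orderOf_eq_prime_pow hxk (hexp x hx), hn]
    rw [← h1, ← mem_powers_iff_mem_zpowers] at hw
    exact hw
  have hne : ∃ a b : G, ⁅a, b⁆ ^ p ^ k ≠ 1 := by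
    by_contra! hcon
    have hall (x : G) (hx : x ∈ commutator G) : x ^ p ^ k = 1 := by
      rw [commutator_eq_closure] at hx
      induction hx using Subgroup.closure_induction with
      | mem x hx => obtain ⟨a, b, rfl⟩ := hx; exact hcon a b
      | one => exact one_pow _
      | mul x y hx _ ihx ihy =>
        rw [← commutator_eq_closure] at hx
        have hxy : Commute x y := (Subgroup.mem_center_iff.1 (hcen hx) y).symm
        rw [hxy.mul_pow, ihx, ihy, one_mul]
      | inv x _ ih => rw [inv_pow, ih, inv_one]
    obtain ⟨c, hc⟩ := hcyc.exists_generator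
    have hck : c ^ p ^ k = 1 := Subtype.ext (hall c c.2)
    have h1 := orderOf_eq_card_of_forall_mem_zpowers hc
    rw [← orderOf_dvd_iff_pow_eq_one, h1, hn, Nat.pow_dvd_pow_iff_le_right hp.one_lt] at hck
    lia
  obtain ⟨a, b, M, hkM, hab, haM, hM⟩ :=
    exists_commutator_pow_ne_one hp hpG hZ hcard hexp hgen hne
  set y := a ^ p ^ k
  have hyc (h : G) : ⁅y, h⁆ = ⁅a, h⁆ ^ p ^ k := commutatorElement_pow_left_of_mem_center hZ a h _
  have hζ : orderOf ⁅y, b⁆ = p := by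
    refine orderOf_eq_prime ?_ (by rwa [hyc])
    rw [hyc, ← pow_mul, ← pow_succ, hexp _ (hmem a b)]
  have hyζ (h : G) : ⁅y, h⁆ ∈ Subgroup.zpowers ⁅y, b⁆ := by
    obtain ⟨m, hm⟩ := hgen _ (hmem a b) hab _ (hmem a h)
    refine mem_powers_iff_mem_zpowers.1 ⟨m, ?_⟩
    change ⁅y, b⁆ ^ m = ⁅y, h⁆
    rw [hyc, hyc, ← hm, ← pow_mul, ← pow_mul, mul_comm]
  let f : G →* Subgroup.zpowers ⁅y, b⁆ := MonoidHom.mk' (fun h ↦ ⟨⁅y, h⁆, hyζ h⟩)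
    fun g h ↦ Subtype.ext (commutatorElement_mul_right_of_mem_center hZ y g h)
  obtain ⟨κ, hκ, hκ0, hκf⟩ := exists_exponent_lift hp
    (ζ := (⟨⁅y, b⁆, Subgroup.mem_zpowers _⟩ : Subgroup.zpowers ⁅y, b⁆))
    (by rwa [Subgroup.orderOf_mk]) (fun x ↦ by
      obtain ⟨i, hi⟩ := x.2
      exact ⟨i, Subtype.ext hi⟩) M f
    (fun g hg ↦ Subtype.ext ((hyc g).trans (hM g hg)))
  have hyZ : y ∉ Subgroup.center G := fun hyZ ↦ hab <| by
    rw [← hyc, commutatorElement_eq_one_iff_mul_comm, Subgroup.mem_center_iff.1 hyZ]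
  have hle : p ^ (k + 1) ≤ p ^ (M + 1) := Nat.pow_le_pow_right hp.pos (by lia)
  obtain ⟨φ, ψ, hφψ⟩ := exists_mulAut_not_commute hp hZ hζ (hZ y b)
    (hp.dvd_choose_pow two_ne_zero (by lia)) haM hyZ hκ (hκ0 _ (hmem y b))
    (fun g ↦ congrArg Subtype.val (hκf g))
  exact hφψ (haut φ ψ)
end

section
/- For a finite group G, the following are equivalent: (1) maol(G) = 2; (2) G is isomorphic to Z/mZ for some m ∈ {3, 4, 6}. -/
theorem totient_eq_two_iff {n : ℕ} : n.totient = 2 ↔ n = 3 ∨ n = 4 ∨ n = 6 := by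
  refine ⟨fun h => ?_, by rintro (rfl | rfl | rfl) <;> decide⟩
  have hdvd : n ∣ 12 := by
    rw [Nat.dvd_iff_prime_pow_dvd_dvd]
    rintro p (_ | k) hp hk
    · simp
    have h1 : p ^ k * (p - 1) ∣ 2 := by
      rw [← Nat.totient_prime_pow_succ hp, ← h]
      exact Nat.totient_dvd_of_dvd hk
    have h2 : p - 1 ≤ 2 := Nat.le_of_dvd two_pos (dvd_of_mul_left_dvd h1)
    have h3 : p ^ k ≤ 2 := Nat.le_of_dvd two_pos (dvd_of_mul_right_dvd h1)
    have h4 : k < p ^ k := k.lt_pow_self hp.one_lt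
    have h5 := hp.two_le
    have h6 : p ≤ 3 := by omega
    have h7 : k ≤ 1 := by omega
    interval_cases p <;> interval_cases k <;> simp_all
  have hle : n ≤ 12 := Nat.le_of_dvd (by norm_num) hdvd
  interval_cases n <;> revert h <;> decide

section Orbits

variable {G : Type*} [Group G]

theorem bddAbove_card_orbit [Finite G] :
    BddAbove (Set.range fun g : G => Nat.card (MulAction.orbit (MulAut G) g)) :=
  (Set.finite_range _).bddAbove

theorem maol_eq_totient_of_isCyclic [Finite G] [IsCyclic G] :
    maol G = (Nat.card G).totient := by
  have : Finite (MulAut G) := Finite.of_injective (fun φ => (φ : G → G)) DFunLike.coe_injective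
  rw [← IsCyclic.card_mulAut G]
  refine le_antisymm (ciSup_le fun g => ?_) ?_
  · exact Nat.card_le_card_of_surjective
      (fun φ : MulAut G => (⟨φ • g, φ, rfl⟩ : MulAction.orbit (MulAut G) g))
      (by rintro ⟨_, φ, rfl⟩; exact ⟨φ, rfl⟩)
  · obtain ⟨g, hg⟩ := IsCyclic.exists_generator (α := G)
    refine le_trans ?_ (le_ciSup bddAbove_card_orbit g)
    refine Nat.card_le_card_of_injective
      (fun φ : MulAut G => (⟨φ • g, φ, rfl⟩ : MulAction.orbit (MulAut G) g)) ?_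
    intro φ ψ h
    have h' : φ g = ψ g := congrArg Subtype.val h
    ext x
    obtain ⟨k, rfl⟩ := Subgroup.mem_zpowers_iff.1 (hg x)
    simp [h']

/-- Every automorphism orbit has at most two elements. -/
def OrbitsLeTwo (G : Type*) [Group G] : Prop :=
  ∀ (g : G) (φ ψ : MulAut G), φ g = g ∨ ψ g = g ∨ φ g = ψ g

theorem orbitsLeTwo_of_maol_le [Finite G] (h : maol G ≤ 2) : OrbitsLeTwo G := by
  intro g φ ψ
  by_contra! hne
  have hcard : Nat.card (MulAction.orbit (MulAut G) g) ≤ 2 :=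
    (le_ciSup bddAbove_card_orbit g).trans h
  refine hcard.not_gt ?_
  rw [Nat.card_coe_set_eq, Set.two_lt_ncard_iff]
  exact ⟨g, φ g, ψ g, MulAction.mem_orbit_self g, ⟨φ, rfl⟩, ⟨ψ, rfl⟩, hne.1.symm, hne.2.1.symm,
    hne.2.2⟩

theorem OrbitsLeTwo.apply_apply (h : OrbitsLeTwo G) (φ : MulAut G) (x : G) : φ (φ x) = x := by
  rcases h x φ (φ * φ) with h | h | h
  · rw [h, h]
  · exact h
  · have h' : x = φ x := φ.injective h
    rw [← h', ← h']

theorem OrbitsLeTwo.mulAut_comm (h : OrbitsLeTwo G) (φ ψ : MulAut G) : φ * ψ = ψ * φ := by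
  have hs : ∀ σ : MulAut G, σ * σ = 1 := fun σ => MulEquiv.ext (h.apply_apply σ)
  have hinv : ∀ σ : MulAut G, σ⁻¹ = σ := fun σ => inv_eq_of_mul_eq_one_left (hs σ)
  rw [← hinv (φ * ψ), mul_inv_rev, hinv, hinv]

end Orbits

section Twist

variable {G : Type*} [Group G] [Finite G]

open Classical in
theorem exists_mulAut_twist (H : Subgroup G) {t : G} (ht : t ∈ H)
    (hind : ∀ u v, u ∉ H → v ∉ H → u * v ∈ H) (hc : ∀ u ∈ H, t * u = u * t)
    (hi : ∀ v ∉ H, t * v * t = v) :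
    ∃ φ : MulAut G, ∀ u ∉ H, φ u = u * t := by
  let f : G →* G := MonoidHom.mk' (fun u => if u ∈ H then u else u * t) (by
    intro u v
    by_cases hu : u ∈ H <;> by_cases hv : v ∈ H
    · simp [hu, hv, H.mul_mem hu hv]
    · simp [hu, hv, H.mul_mem_cancel_left hu, mul_assoc]
    · simp [hu, hv, H.mul_mem_cancel_right hv, mul_assoc, hc v hv]
    · have := hi v hv
      rw [mul_assoc] at this
      simp [hu, hv, hind u v hu hv, mul_assoc, this])
  have hf : Function.Injective f := by
    rw [injective_iff_map_eq_one]
    intro a ha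
    by_cases h : a ∈ H
    · simpa [f, h] using ha
    · have : a * t = 1 := by simpa [f, h] using ha
      exact absurd (eq_inv_of_mul_eq_one_left this ▸ H.inv_mem ht) h
  exact ⟨MulEquiv.ofBijective f (Finite.injective_iff_bijective.1 hf), fun u hu => by simp [f, hu]⟩

theorem exists_mulAut_mul {G : Type*} [CommGroup G] [Finite G] (f : G →* G)
    (hf : ∀ x, f (f x) = 1) : ∃ φ : MulAut G, ∀ x, φ x = x * f x := by
  let F : G →* G := MonoidHom.id G * f
  have hF : Function.Injective F := by
    rw [injective_iff_map_eq_one]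
    intro a ha
    have h1 : a * f a = 1 := ha
    have h2 := congrArg f h1
    rw [map_mul, hf, mul_one, map_one] at h2
    rwa [h2, mul_one] at h1
  exact ⟨MulEquiv.ofBijective F (Finite.injective_iff_bijective.1 hF), fun x => rfl⟩

end Twist

section Noncommutative

variable {G : Type*} [Group G] [Finite G]

open Subgroup
open scoped IsMulCommutative

theorem OrbitsLeTwo.sq_mem_center {G : Type*} [Group G] (h : OrbitsLeTwo G) (a : G) :
    a * a ∈ center G := by
  rw [mem_center_iff]
  intro g
  have := h.apply_apply (MulAut.conj a) g
  simp only [MulAut.conj_apply] at this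
  rw [eq_comm, ← mul_inv_eq_iff_eq_mul]
  simpa [mul_assoc] using this

theorem OrbitsLeTwo.exists_commutator {G : Type*} [Group G] (h : OrbitsLeTwo G) {x y : G}
    (hxy : y * x ≠ x * y) : ∃ z ∈ center G, z * z = 1 ∧ z ≠ 1 ∧ y * x = z * (x * y) := by
  have hz : y * x * (x * y)⁻¹ ∈ center G := by
    rw [mem_center_iff]
    intro g
    have h1 : MulAut.conj (y * x) = MulAut.conj (x * y) := by
      rw [map_mul, map_mul, h.mulAut_comm]
    have h2 : MulAut.conj (y * x * (x * y)⁻¹) g = g := by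
      rw [map_mul, map_inv, h1, mul_inv_cancel, MulAut.one_apply]
    rw [MulAut.conj_apply, mul_inv_eq_iff_eq_mul] at h2
    exact h2.symm
  obtain ⟨z, hzdef⟩ : ∃ z, z = y * x * (x * y)⁻¹ := ⟨_, rfl⟩
  rw [← hzdef] at hz
  have hyx : y * x = z * (x * y) := by rw [hzdef]; group
  have hzc := mem_center_iff.1 hz
  refine ⟨z, hz, ?_, ?_, hyx⟩
  · have h1 := mem_center_iff.1 (h.sq_mem_center y) x
    have h2 : y * y * x = z * z * (x * (y * y)) := by
      calc y * y * x = y * (z * (x * y)) := by rw [mul_assoc, hyx]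
        _ = z * (y * x) * y := by simp only [← mul_assoc, hzc y]
        _ = z * z * (x * (y * y)) := by rw [hyx]; simp only [mul_assoc]
    rw [← h1] at h2
    exact (mul_eq_right.1 h2.symm)
  · rintro rfl
    exact hxy (by rw [hyx, one_mul])

theorem OrbitsLeTwo.mul_eq_or {G : Type*} [Group G] (h : OrbitsLeTwo G) {x y z : G}
    (hz1 : z ≠ 1) (hyx : y * x = z * (x * y)) (u : G) :
    u * x = x * u ∨ u * x = z * (x * u) := by
  rcases h x (MulAut.conj u) (MulAut.conj y) with h | h | h <;>
    simp only [MulAut.conj_apply, mul_inv_eq_iff_eq_mul] at h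
  · exact Or.inl h
  · rw [h] at hyx
    exact absurd (mul_eq_right.1 hyx.symm) hz1
  · right
    rw [h, hyx]
    group

theorem OrbitsLeTwo.twist {x y z t : G} (h : OrbitsLeTwo G) (hz : z ∈ center G)
    (hzz : z * z = 1) (hz1 : z ≠ 1) (hyx : y * x = z * (x * y)) (htx : t * x = x * t)
    (hc : ∀ u, u * x = x * u → t * u = u * t)
    (hi : ∀ v, v * x = z * (x * v) → t * v * t = v) : t = 1 ∨ y * t = z * y := by
  have hzc := mem_center_iff.1 hz
  have hmem : ∀ u, u ∈ centralizer {x} ↔ u * x = x * u := fun u => by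
    rw [mem_centralizer_singleton_iff]
  have hnot : ∀ u, u ∉ centralizer {x} → u * x = z * (x * u) := fun u hu =>
    (h.mul_eq_or hz1 hyx u).resolve_left fun h' => hu ((hmem u).2 h')
  have hy : y ∉ centralizer {x} := fun hy => by
    rw [(hmem y).1 hy] at hyx
    exact hz1 (mul_eq_right.1 hyx.symm)
  obtain ⟨φ, hφ⟩ := exists_mulAut_twist (centralizer {x}) ((hmem t).2 htx)
    (fun u v hu hv => (hmem _).2 (by
      calc u * v * x = u * (z * (x * v)) := by rw [mul_assoc, hnot v hv]
        _ = z * (u * x) * v := by simp only [← mul_assoc, hzc u]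
        _ = z * z * (x * (u * v)) := by rw [hnot u hu]; simp only [mul_assoc]
        _ = x * (u * v) := by rw [hzz, one_mul]))
    (fun u hu => hc u ((hmem u).1 hu)) (fun v hv => hi v (hnot v hv))
  have hconj : MulAut.conj x y = z * y := by
    have : x * y = z * (y * x) := by rw [hyx, ← mul_assoc, hzz, one_mul]
    rw [MulAut.conj_apply, this]
    group
  rcases h y φ (MulAut.conj x) with h | h | h
  · left
    rw [hφ y hy] at h
    exact mul_eq_left.1 h
  · rw [hconj] at h
    exact absurd (mul_eq_right.1 h) hz1
  · right
    rw [← hφ y hy, h, hconj]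

theorem OrbitsLeTwo.eq_of_involution {x y z w : G} (h : OrbitsLeTwo G) (hz : z ∈ center G)
    (hzz : z * z = 1) (hz1 : z ≠ 1) (hyx : y * x = z * (x * y)) (hw : w ∈ center G)
    (hww : w * w = 1) : w = 1 ∨ w = z := by
  have hwc := mem_center_iff.1 hw
  refine (h.twist hz hzz hz1 hyx (hwc x).symm (fun u _ => (hwc u).symm) fun v _ => ?_).imp id
    fun h' => ?_
  · rw [← hwc, mul_assoc, hww, mul_one]
  · rw [hwc y] at h'
    exact mul_right_cancel h'

theorem OrbitsLeTwo.sq_ne_commutator {x y z : G} (h : OrbitsLeTwo G) (hz : z ∈ center G)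
    (hzz : z * z = 1) (hz1 : z ≠ 1) (hyx : y * x = z * (x * y)) : x * x ≠ z := by
  intro hx
  have hzc := mem_center_iff.1 hz
  rcases h.twist hz hzz hz1 hyx rfl (fun u hu => hu.symm) (fun v hv => by
    rw [mul_assoc, hv, ← mul_assoc, hzc x, mul_assoc, ← mul_assoc x, hx, ← mul_assoc, hzz,
      one_mul]) with h' | h'
  · subst h'
    exact hz1 (by simpa using hx.symm)
  · rw [hyx] at h'
    have := mul_left_cancel h'
    rw [mul_eq_right] at this
    subst this
    exact hz1 (by simpa using hx.symm)

theorem OrbitsLeTwo.mul_comm_of_finite (h : OrbitsLeTwo G) (x y : G) : x * y = y * x := by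
  by_contra hxy
  obtain ⟨z, hz, hzz, hz1, hyx⟩ := h.exists_commutator (Ne.symm hxy)
  have hzc := mem_center_iff.1 hz
  have hzx : x * y = z * (y * x) := by rw [hyx, ← mul_assoc, hzz, one_mul]
  have hzxy : y * (x * y) = z * (x * y * y) := by rw [← mul_assoc, hyx, mul_assoc]
  let S : Subgroup (center G) := (powMonoidHom (α := center G) 2).range
  have hindex : S.index ≤ 2 := by
    rw [index_range]
    have hsub : ((powMonoidHom (α := center G) 2).ker : Set (center G)) ⊆
        {1, ⟨z, hz⟩} := by
      intro w hw
      have hw' : w ^ 2 = 1 := hw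
      have : (w : G) * w = 1 := by simpa [pow_two] using congrArg Subtype.val hw'
      rcases h.eq_of_involution hz hzz hz1 hyx w.2 this with h' | h'
      · exact Or.inl (Subtype.ext h')
      · exact Or.inr (Subtype.ext h')
    exact (Set.ncard_le_ncard hsub).trans
      ((Set.ncard_insert_le _ _).trans_eq (by rw [Set.ncard_singleton]))
  have key : ∀ a b : G, b * a = z * (a * b) →
      (⟨z, hz⟩ * ⟨a * a, h.sq_mem_center a⟩ : center G) ∉ S := by
    rintro a b hba ⟨c, hc⟩
    have hc' : (c : G) * c = z * (a * a) := by
      simpa [pow_two] using congrArg Subtype.val hc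
    have hcc := mem_center_iff.1 (center G |>.inv_mem c.2)
    refine h.sq_ne_commutator (x := a * (c : G)⁻¹) (y := b) hz hzz hz1 ?_ ?_
    · rw [← mul_assoc, hba, mul_assoc, mul_assoc, mul_assoc, hcc b]
    · have h1 : a * (c : G)⁻¹ * (a * (c : G)⁻¹) = a * a * (c * c : G)⁻¹ := by
        rw [mul_inv_rev, mul_assoc, ← mul_assoc _ a, ← hcc a]; simp only [mul_assoc]
      rw [h1, hc', mul_inv_rev, ← mul_assoc, mul_inv_cancel, one_mul]
      exact inv_eq_of_mul_eq_one_left hzz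
  have hS2 : S.index = 2 := by
    have h0 : S.index ≠ 0 := FiniteIndex.index_ne_zero
    have h1 : S.index ≠ 1 := fun h1 => key x y hyx (by rw [index_eq_one.1 h1]; trivial)
    omega
  have hprod := (mul_mem_iff_of_index_two hS2).2
    (iff_of_false (key x y hyx) (key y x hzx))
  refine key (x * y) y hzxy ?_
  convert hprod using 1
  ext
  have hyy := mem_center_iff.1 (h.sq_mem_center y)
  change z * (x * y * (x * y)) = z * (x * x) * (z * (y * y))
  calc z * (x * y * (x * y)) = z * (x * (y * x) * y) := by simp only [mul_assoc]
    _ = z * (x * z * (x * y) * y) := by rw [hyx, ← mul_assoc x]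
    _ = z * (x * x) * (z * (y * y)) := by
      rw [hzc x, ← mul_assoc (z * (x * x)), hzc (z * (x * x))]
      simp only [mul_assoc]

end Noncommutative

theorem exists_addMonoidHom_apply_eq_zero {p : ℕ} [Fact p.Prime] {V : Type*} [AddCommGroup V]
    (hpV : ∀ v : V, p • v = 0) (hV : p < Nat.card V) (t : V) :
    ∃ f : V →+ ZMod p, f ≠ 0 ∧ f t = 0 := by
  have : Module (ZMod p) V := AddCommGroup.zmodModule hpV
  have hlt : Submodule.span (ZMod p) {t} < ⊤ := by
    rw [lt_top_iff_ne_top]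
    intro htop
    have hle : Nat.card V ≤ Nat.card (ZMod p) := by
      refine Nat.card_le_card_of_surjective (fun c : ZMod p => c • t) fun q => ?_
      exact Submodule.mem_span_singleton.1 (htop ▸ Submodule.mem_top)
    rw [Nat.card_zmod] at hle
    omega
  obtain ⟨f, hf0, hf⟩ := Submodule.exists_le_ker_of_lt_top _ hlt
  exact ⟨f.toAddMonoidHom, fun h => hf0 (LinearMap.ext fun v => DFunLike.congr_fun h v),
    hf (Submodule.mem_span_singleton_self t)⟩

section Commutative

variable {G : Type*} [CommGroup G] [Finite G]

theorem exists_hom_zpowers {p : ℕ} (hp : p.Prime)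
    (hcard : p < Nat.card (powMonoidHom p : G →* G).ker) {t : G} (ht : t ^ p = 1) (ht1 : t ≠ 1) :
    ∃ f : G →* G, f t = 1 ∧ (∃ x, f x ≠ 1) ∧ ∀ x, f x ∈ Subgroup.zpowers t := by
  have := Fact.mk hp
  let N : Subgroup G := (powMonoidHom p : G →* G).range
  have hpQ : ∀ q : Additive (G ⧸ N), p • q = 0 := by
    intro q
    obtain ⟨x, hx⟩ := QuotientGroup.mk_surjective (s := N) q.toMul
    change q.toMul ^ p = 1
    rw [← hx, ← QuotientGroup.mk_pow, QuotientGroup.eq_one_iff]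
    exact ⟨x, rfl⟩
  have hQ : p < Nat.card (Additive (G ⧸ N)) :=
    hcard.trans_eq (Subgroup.index_range (f := (powMonoidHom p : G →* G))).symm
  obtain ⟨f, hf0, hf⟩ := exists_addMonoidHom_apply_eq_zero hpQ hQ (Additive.ofMul (t : G ⧸ N))
  let k : ℤ →+ Additive G := zmultiplesHom _ (Additive.ofMul t)
  have hk : k p = 0 := by
    change t ^ (p : ℤ) = 1
    rw [zpow_natCast, ht]
  let e : ZMod p →+ Additive G := ZMod.lift p ⟨k, hk⟩
  have he : Function.Injective e := by
    refine (ZMod.lift_injective _).2 fun m hm => ?_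
    have hm' : t ^ m = 1 := hm
    rwa [ZMod.intCast_zmod_eq_zero_iff_dvd, ← orderOf_eq_prime ht ht1, orderOf_dvd_iff_zpow_eq_one]
  let F : G →* G := (AddMonoidHom.toMultiplicative (e.comp f)).comp
    (QuotientGroup.mk' N)
  have hF : ∀ x, F x = (e (f (Additive.ofMul (x : G ⧸ N)))).toMul := fun x => rfl
  refine ⟨F, ?_, ?_, fun x => ?_⟩
  · rw [hF, hf, map_zero, toMul_zero]
  · obtain ⟨q, hq⟩ := DFunLike.ne_iff.1 hf0
    obtain ⟨x, hx⟩ := QuotientGroup.mk_surjective (s := N) q.toMul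
    refine ⟨x, fun h => hq ?_⟩
    rw [hF, hx] at h
    exact he (h.trans (map_zero e).symm)
  · obtain ⟨m, hm⟩ := ZMod.intCast_surjective (f (Additive.ofMul (x : G ⧸ N)))
    rw [hF, ← hm]
    exact ⟨m, by simp [e, k]⟩

/-- In a group with a nontrivial element `t` of order `p` and more than `p` elements killed by
`p`, there is a proper subgroup off which every element is translated, by an automorphism,
by a nontrivial power of `t`. -/
theorem exists_subgroup_mulAut_translate {p : ℕ} (hp : p.Prime)
    (hcard : p < Nat.card (powMonoidHom p : G →* G).ker) {t : G} (ht : t ^ p = 1) (ht1 : t ≠ 1) :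
    ∃ H : Subgroup G, H ≠ ⊤ ∧ ∀ v ∉ H, ∃ (φ : MulAut G) (s : G), s ∈ Subgroup.zpowers t ∧ s ≠ 1 ∧
      φ v = v * s ∧ φ (φ v) = v * s ^ 2 := by
  obtain ⟨f, hft, ⟨x, hx⟩, hf⟩ := exists_hom_zpowers hp hcard ht ht1
  have hff : ∀ x, f (f x) = 1 := fun x => by
    obtain ⟨m, hm⟩ := hf x
    simp [← hm, hft]
  obtain ⟨φ, hφ⟩ := exists_mulAut_mul f hff
  refine ⟨f.ker, fun h => hx (f.mem_ker.1 (h ▸ Subgroup.mem_top x)), fun v hv =>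
    ⟨φ, f v, hf v, hv, hφ v, ?_⟩⟩
  rw [hφ v, map_mul, hφ, hφ, hff, mul_one, pow_two, mul_assoc]

theorem OrbitsLeTwo.card_pow_ker_le (h : OrbitsLeTwo G) {p : ℕ} (hp : p.Prime) :
    Nat.card (powMonoidHom p : G →* G).ker ≤ p := by
  by_contra! hcard
  let K : Subgroup G := (powMonoidHom p : G →* G).ker
  have hK : ∀ t, t ∈ K ↔ t ^ p = 1 := fun t => Iff.rfl
  by_cases hp2 : p = 2
  · subst hp2
    have hz : ∀ t s : G, t ^ 2 = 1 → s ∈ Subgroup.zpowers t → s ≠ 1 → s = t := by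
      rintro t _ ht ⟨m, rfl⟩ hs
      have ht' : t ^ (2 : ℤ) = 1 := by exact_mod_cast ht
      rcases Int.even_or_odd' m with ⟨j, rfl | rfl⟩
      · simp [zpow_mul, ht'] at hs
      · simp [zpow_add, zpow_mul, ht']
    obtain ⟨t, t', ht, ht', ht1, ht1', htt⟩ :
        ∃ t t' : G, t ^ 2 = 1 ∧ t' ^ 2 = 1 ∧ t ≠ 1 ∧ t' ≠ 1 ∧ t ≠ t' := by
      have hcard' : 2 < (K : Set G).ncard := hcard
      obtain ⟨a, b, c, ha, hb, hc, hab, hac, hbc⟩ := (Set.two_lt_ncard_iff).1 hcard'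
      by_cases ha1 : a = 1
      · exact ⟨b, c, hb, hc, ha1 ▸ hab.symm, ha1 ▸ hac.symm, hbc⟩
      by_cases hb1 : b = 1
      · exact ⟨a, c, ha, hc, ha1, hb1 ▸ hbc.symm, hac⟩
      · exact ⟨a, b, ha, hb, ha1, hb1, hab⟩
    obtain ⟨H, hH, hHφ⟩ := exists_subgroup_mulAut_translate hp hcard ht ht1
    obtain ⟨H', hH', hHφ'⟩ := exists_subgroup_mulAut_translate hp hcard ht' ht1'
    obtain ⟨v, hv, hv'⟩ : ∃ v, v ∉ H ∧ v ∉ H' := by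
      by_contra! hcov
      obtain ⟨x, hx⟩ : ∃ x, x ∉ H := by
        by_contra! hall
        exact hH (Subgroup.eq_top_iff' H |>.2 hall)
      obtain ⟨y, hy⟩ : ∃ y, y ∉ H' := by
        by_contra! hall
        exact hH' (Subgroup.eq_top_iff' H' |>.2 hall)
      have hx' := hcov x hx
      have hy' : y ∈ H := by_contra fun h => hy (hcov y h)
      have hxy : x * y ∉ H := fun h => hx ((H.mul_mem_cancel_right hy').1 h)
      exact hy ((H'.mul_mem_cancel_left hx').1 (hcov _ hxy))
    obtain ⟨φ, s, hs, hs1, hφ, -⟩ := hHφ v hv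
    obtain ⟨ψ, s', hs', hs1', hψ, -⟩ := hHφ' v hv'
    rcases h v φ ψ with h | h | h
    · exact hs1 (mul_eq_left.1 (hφ ▸ h))
    · exact hs1' (mul_eq_left.1 (hψ ▸ h))
    · rw [hφ, hψ, mul_right_inj, hz t s ht hs hs1, hz t' s' ht' hs' hs1'] at h
      exact htt h
  · have : Nontrivial K := Finite.one_lt_card_iff_nontrivial.1 (hp.one_lt.trans hcard)
    obtain ⟨⟨t, ht⟩, ht1⟩ := exists_ne (1 : K)
    have ht1' : t ≠ 1 := fun h => ht1 (Subtype.ext h)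
    obtain ⟨H, hH, hHφ⟩ := exists_subgroup_mulAut_translate hp hcard ht ht1'
    obtain ⟨v, hv⟩ : ∃ v, v ∉ H := by
      by_contra! hall
      exact hH (Subgroup.eq_top_iff' H |>.2 hall)
    obtain ⟨φ, s, ⟨m, rfl⟩, hs1, -, hφ⟩ := hHφ v hv
    rw [h.apply_apply, eq_comm, mul_eq_left] at hφ
    have hsp : (t ^ m) ^ p = 1 := by
      rw [← zpow_natCast, ← zpow_mul, mul_comm, zpow_mul, zpow_natCast, (hK t).1 ht, one_zpow]
    have hco : Nat.Coprime 2 p := (Nat.coprime_primes Nat.prime_two hp).2 (Ne.symm hp2)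
    exact hs1 (by simpa [hco.gcd_eq_one] using (pow_gcd_eq_one (a := t ^ m)).2 ⟨hφ, hsp⟩)

theorem card_pow_ker_mul_le (m n : ℕ) :
    Nat.card (powMonoidHom (m * n) : G →* G).ker ≤
      Nat.card (powMonoidHom m : G →* G).ker * Nat.card (powMonoidHom n : G →* G).ker := by
  let K : Subgroup G := (powMonoidHom (m * n) : G →* G).ker
  let f : K →* G := (powMonoidHom n).comp K.subtype
  change Nat.card K ≤ _
  rw [← f.ker.card_mul_index, Subgroup.index_ker, mul_comm]
  refine Nat.mul_le_mul (Subgroup.card_le_of_le ?_) ?_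
  · rintro _ ⟨⟨x, hx⟩, rfl⟩
    have hx' : x ^ (m * n) = 1 := hx
    change (x ^ n) ^ m = 1
    rw [← pow_mul, mul_comm, hx']
  · exact Nat.card_le_card_of_injective
      (fun x : f.ker => (⟨x.1.1, x.2⟩ : (powMonoidHom n : G →* G).ker))
      fun x y hxy => Subtype.ext (Subtype.ext (Subtype.mk.inj hxy))

theorem OrbitsLeTwo.isCyclic (h : OrbitsLeTwo G) : IsCyclic G := by
  have key : ∀ n : ℕ, 0 < n → Nat.card (powMonoidHom n : G →* G).ker ≤ n := by
    intro n
    induction n using induction_on_primes with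
    | zero => simp
    | one =>
      intro _
      have : (powMonoidHom 1 : G →* G).ker = ⊥ := by
        ext x
        simp [MonoidHom.mem_ker]
      rw [this, Subgroup.card_bot]
    | prime_mul p n hp ih =>
      intro hn
      exact (card_pow_ker_mul_le p n).trans
        (Nat.mul_le_mul (h.card_pow_ker_le hp) (ih (Nat.pos_of_mul_pos_left hn)))
  classical
  have := Fintype.ofFinite G
  refine isCyclic_of_card_pow_eq_one_le fun n hn => ?_
  refine le_trans (le_of_eq ?_) (key n hn)
  rw [← Fintype.card_subtype, ← Nat.card_eq_fintype_card]
  rfl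

end Commutative

theorem OrbitsLeTwo.isCyclic_of_finite {G : Type*} [Group G] [Finite G] (h : OrbitsLeTwo G) :
    IsCyclic G :=
  let _ : CommGroup G := { ‹Group G› with mul_comm := h.mul_comm_of_finite }
  OrbitsLeTwo.isCyclic h

theorem stmt_11 (G : Type*) [Group G] [Finite G] :
    maol G = 2 ↔ ∃ m ∈ ({3, 4, 6} : Set ℕ), Nonempty (G ≃* Multiplicative (ZMod m)) := by
  constructor
  · intro h
    have hcyc := (orbitsLeTwo_of_maol_le h.le).isCyclic_of_finite
    rw [maol_eq_totient_of_isCyclic, totient_eq_two_iff] at h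
    exact ⟨Nat.card G, h, ⟨(zmodCyclicMulEquiv hcyc).symm⟩⟩
  · rintro ⟨m, hm, ⟨e⟩⟩
    have : IsCyclic G := isCyclic_of_surjective e.symm e.symm.surjective
    rw [maol_eq_totient_of_isCyclic, Nat.card_congr e.toEquiv, totient_eq_two_iff]
    rw [show Nat.card (Multiplicative (ZMod m)) = m from Nat.card_zmod m]
    exact hm
end

section
/- Let ι be a nonempty finite index set and let (S_i)_{i ∈ ι} be a family of nonabelian finite simple groups. If the direct product T = ∏_{i ∈ ι} S_i satisfies mccl(T) ≤ 23, then T is isomorphic to the alternating group Alt(5) of degree 5. -/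
/-- `mccl G` is the maximum conjugacy class length of `G`. -/
noncomputable def mccl (G : Type*) [Group G] : ℕ :=
  ⨆ g : G, Nat.card (MulAction.orbit (ConjAct G) g)

open Subgroup
open scoped commutatorElement

section SimpleGroup

variable {G : Type*} [Group G]

theorem toPermHom_quotient_ne_one {H : Subgroup G} (hH : H ≠ ⊤) :
    MulAction.toPermHom G (G ⧸ H) ≠ 1 := fun h ↦ hH <| by
  rw [eq_top_iff]
  intro g _
  have := DFunLike.congr_fun (DFunLike.congr_fun h g) ((1 : G) : G ⧸ H)
  simpa [QuotientGroup.eq, eq_comm] using this.symm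

variable [IsSimpleGroup G]

theorem center_eq_bot_of_noncomm (hna : ¬ ∀ a b : G, a * b = b * a) : center G = ⊥ := by
  refine (IsSimpleGroup.eq_bot_or_eq_top_of_normal (center G) inferInstance).resolve_right fun h ↦
    hna fun a b ↦ ?_
  exact (mem_center_iff.mp (h ▸ mem_top b : b ∈ center G) a)

theorem eq_one_of_forall_commute (hna : ¬ ∀ a b : G, a * b = b * a) {x : G}
    (h : ∀ g, g * x = x * g) : x = 1 := by
  have : x ∈ center G := mem_center_iff.mpr h
  rwa [center_eq_bot_of_noncomm hna, mem_bot] at this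

theorem centralizer_singleton_ne_top (hna : ¬ ∀ a b : G, a * b = b * a) {x : G} (hx : x ≠ 1) :
    centralizer {x} ≠ ⊤ := by
  refine fun h ↦ hx (eq_one_of_forall_commute hna fun g ↦ ?_)
  exact mem_centralizer_singleton_iff.mp (h ▸ mem_top g)

/-- A nonabelian simple group acting nontrivially on `α` embeds in the alternating group on `α`. -/
theorem exists_injective_alternatingGroup (hna : ¬ ∀ a b : G, a * b = b * a) (α : Type*)
    [Fintype α] [DecidableEq α] (f : G →* Equiv.Perm α) (hf : f ≠ 1) :
    ∃ φ : G →* alternatingGroup α, Function.Injective φ := by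
  have hinj : Function.Injective f := by
    rw [← MonoidHom.ker_eq_bot_iff]
    refine (IsSimpleGroup.eq_bot_or_eq_top_of_normal f.ker inferInstance).resolve_right fun h ↦ ?_
    exact hf (MonoidHom.ker_eq_top_iff.mp h)
  have hsign : ∀ g, Equiv.Perm.sign (f g) = 1 := by
    have h := (IsSimpleGroup.eq_bot_or_eq_top_of_normal (Equiv.Perm.sign.comp f).ker
      inferInstance).resolve_left fun h ↦ by
        rw [MonoidHom.ker_eq_bot_iff] at h
        exact hna fun a b ↦ h (by simp only [map_mul, mul_comm])
    exact fun g ↦ (h ▸ mem_top g : g ∈ (Equiv.Perm.sign.comp f).ker)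
  exact ⟨f.codRestrict _ hsign, fun a b h ↦ hinj (congrArg Subtype.val h)⟩

variable [Finite G]

theorem not_isPGroup_of_noncomm (hna : ¬ ∀ a b : G, a * b = b * a) (p : ℕ) [Fact p.Prime] :
    ¬ IsPGroup p G := fun h ↦ by
  have := h.center_nontrivial
  rw [center_eq_bot_of_noncomm hna] at this
  exact not_nontrivial _ this

theorem two_mul_card_dvd_factorial_index (hna : ¬ ∀ a b : G, a * b = b * a) {H : Subgroup G}
    (hH : H ≠ ⊤) : 2 * Nat.card G ∣ H.index.factorial := by
  classical
  have := Fintype.ofFinite (G ⧸ H)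
  obtain ⟨φ, hφ⟩ := exists_injective_alternatingGroup hna _ _ (toPermHom_quotient_ne_one hH)
  have hnt : Nontrivial (G ⧸ H) :=
    Finite.one_lt_card_iff_nontrivial.mp (one_lt_index_of_ne_top hH)
  have h2 := two_mul_nat_card_alternatingGroup (α := G ⧸ H)
  rw [Nat.card_perm] at h2
  rw [index, ← h2]
  exact mul_dvd_mul_left 2 (card_dvd_of_injective φ hφ)

/-- A Sylow subgroup which is central in its normalizer cannot occur. -/
theorem not_normalizer_le_centralizer (hna : ¬ ∀ a b : G, a * b = b * a) {p : ℕ} [Fact p.Prime]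
    (hp : p ∣ Nat.card G) (P : Sylow p G) :
    ¬ normalizer (P : Set G) ≤ centralizer (P : Set G) := fun h ↦ by
  have hc := MonoidHom.ker_transferSylow_isComplement' P h
  rcases IsSimpleGroup.eq_bot_or_eq_top_of_normal (MonoidHom.transferSylow P h).ker
    inferInstance with h' | h'
  · rw [h', isComplement'_bot_left] at hc
    exact not_isPGroup_of_noncomm hna p (IsPGroup.of_equiv (hc ▸ P.2) topEquiv)
  · rw [h', isComplement'_top_left] at hc
    exact P.ne_bot_of_dvd_card hp hc

theorem five_le_index (hna : ¬ ∀ a b : G, a * b = b * a) {H : Subgroup G} (hH : H ≠ ⊤) :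
    5 ≤ H.index := by
  have h3 : ∀ K : Subgroup G, K ≠ ⊤ → K.index ≠ 3 := fun K hK h ↦ by
    have h1 := two_mul_card_dvd_factorial_index hna hK
    rw [h, show Nat.factorial 3 = 2 * 3 from rfl] at h1
    have h2 := Nat.dvd_of_mul_dvd_mul_left two_pos h1
    have hc : Nat.card G = 3 := ((Nat.dvd_prime Nat.prime_three).mp h2).resolve_left
      Finite.one_lt_card.ne'
    have := Fact.mk Nat.prime_three
    have := isCyclic_of_prime_card hc
    exact hna fun a b ↦ IsCyclic.isMulCommutative.is_comm.comm a b
  by_contra! hlt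
  have h1 := one_lt_index_of_ne_top hH
  have hd := two_mul_card_dvd_factorial_index hna hH
  have hc : 1 < Nat.card G := Finite.one_lt_card
  generalize hn : H.index = n at *
  interval_cases n
  · have := Nat.le_of_dvd (by decide) hd
    simp [Nat.factorial] at this
    omega
  · exact h3 H hH hn
  · have h12 : Nat.card G ∣ 12 := Nat.dvd_of_mul_dvd_mul_left two_pos hd
    have := Fact.mk Nat.prime_two
    obtain ⟨P⟩ : Nonempty (Sylow 2 G) := inferInstance
    have hi : (P : Subgroup G).index ∣ 3 := by
      refine (Nat.Coprime.dvd_mul_left (m := 4) ?_).mp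
        ((index_dvd_card (P : Subgroup G)).trans h12)
      have := P.not_dvd_index
      exact (Nat.Coprime.pow_right 2 ((Nat.prime_two.coprime_iff_not_dvd.mpr this).symm))
    rcases (Nat.dvd_prime Nat.prime_three).mp hi with hi | hi
    · exact not_isPGroup_of_noncomm hna 2
        (IsPGroup.of_equiv ((index_eq_one.mp hi) ▸ P.2) topEquiv)
    · exact h3 P (fun h ↦ by simp [h] at hi) hi

end SimpleGroup

section Centralizer

variable {G : Type*} [Group G]

theorem mem_zpowers_mul_of_coprime {x y : G} (h : Commute x y)
    (hc : (orderOf x).Coprime (orderOf y)) : x ∈ zpowers (x * y) := by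
  obtain ⟨k, hk1, hk2⟩ := Nat.chineseRemainder hc 1 0
  refine ⟨k, ?_⟩
  have e1 : x ^ k = x := by simpa using pow_eq_pow_iff_modEq.mpr hk1
  have e2 : y ^ k = 1 := by simpa using pow_eq_pow_iff_modEq.mpr hk2
  simp [h.mul_pow, e1, e2]

theorem centralizer_mul_le_left {x y : G} (h : Commute x y)
    (hc : (orderOf x).Coprime (orderOf y)) : centralizer {x * y} ≤ centralizer {x} := by
  intro g hg
  rw [mem_centralizer_singleton_iff] at hg ⊢
  obtain ⟨k, hk⟩ := mem_zpowers_mul_of_coprime h hc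
  have : Commute g ((x * y) ^ k) := Commute.zpow_right hg k
  rwa [show (x * y) ^ k = x from hk] at this

theorem centralizer_mul_le_right {x y : G} (h : Commute x y)
    (hc : (orderOf x).Coprime (orderOf y)) : centralizer {x * y} ≤ centralizer {y} :=
  h.eq ▸ centralizer_mul_le_left h.symm hc.symm

end Centralizer

theorem two_mul_le_of_sq_dvd_factorial {p m : ℕ} (hp : p.Prime) (hp3 : 3 ≤ p)
    (h : p ^ 2 ∣ m.factorial) : 2 * p ≤ m := by
  by_contra! hm
  have hlog : Nat.log p m < 2 := Nat.log_lt_of_lt_pow' two_ne_zero (by nlinarith)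
  rw [hp.pow_dvd_factorial_iff hlog] at h
  have : m / p < 2 := Nat.div_lt_of_lt_mul (by omega)
  simp at h
  omega

section SmallClasses

variable {G : Type*} [Group G] [Finite G]

theorem relIndex_centralizer_le (hcl : ∀ x : G, (centralizer {x}).index ≤ 23) (x : G)
    (H : Subgroup G) : (centralizer {x}).relIndex H ≤ 23 := by
  have h := relIndex_le_of_le_right (le_top : H ≤ ⊤) (H := centralizer {x})
    (by rw [relIndex_top_right]; exact index_ne_zero_of_finite)
  rw [relIndex_top_right] at h
  exact h.trans (hcl x)

theorem relIndex_centralizer_sylow (hcl : ∀ x : G, (centralizer {x}).index ≤ 23) {p : ℕ}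
    [Fact p.Prime] (hp : 5 ≤ p) (P : Sylow p G) (y : G) :
    (centralizer {y}).relIndex P = 1 ∨ (centralizer {y}).relIndex P = p := by
  have h1 := relIndex_centralizer_le hcl y P
  obtain ⟨k, hk⟩ := P.2.exists_card_eq
  have h2 : (centralizer {y}).relIndex P ∣ p ^ k := hk ▸ relIndex_dvd_card _ _
  obtain ⟨j, -, hj⟩ := (Nat.dvd_prime_pow Fact.out).mp h2
  rw [hj] at h1 ⊢
  have : j < 2 := by
    by_contra! h
    have := Nat.pow_le_pow_right (show 0 < p by omega) h
    nlinarith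
  interval_cases j <;> simp

theorem commutatorElement_mem_of_relIndex_eq_prime {p : ℕ} [hp : Fact p.Prime] {P C : Subgroup G}
    (hP : IsPGroup p P) (h : C.relIndex P = p) {a b : G} (ha : a ∈ P) (hb : b ∈ P) :
    ⁅a, b⁆ ∈ C := by
  have hnc : (C.subgroupOf P).Normal := by
    apply normal_of_index_eq_minFac_card
    obtain ⟨k, hk⟩ := hP.exists_card_eq
    have hd : p ∣ Nat.card P := h ▸ relIndex_dvd_card C P
    have hk0 : k ≠ 0 := by
      rintro rfl
      rw [hk, pow_zero, Nat.dvd_one] at hd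
      exact hp.out.one_lt.ne' hd
    rw [hk, Nat.Prime.pow_minFac hp.out hk0]
    exact h
  have hcyc : IsCyclic (P ⧸ C.subgroupOf P) := isCyclic_of_prime_card (p := p) h
  have : (⁅(⟨a, ha⟩ : P), ⟨b, hb⟩⁆ : P) ∈ C.subgroupOf P := by
    rw [← QuotientGroup.eq_one_iff]
    change ⁅((⟨a, ha⟩ : P) : P ⧸ C.subgroupOf P), ((⟨b, hb⟩ : P) : P ⧸ C.subgroupOf P)⁆ = 1
    rw [commutatorElement_eq_one_iff_mul_comm]
    exact IsCyclic.isMulCommutative.is_comm.comm _ _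
  exact mem_subgroupOf.mp this

variable [IsSimpleGroup G]

theorem commute_of_mem_sylow (hna : ¬ ∀ a b : G, a * b = b * a)
    (hcl : ∀ x : G, (centralizer {x}).index ≤ 23) {p : ℕ} [Fact p.Prime] (hp : 5 ≤ p)
    (P : Sylow p G) {a b : G} (ha : a ∈ P) (hb : b ∈ P) : a * b = b * a := by
  rw [← commutatorElement_eq_one_iff_mul_comm]
  refine eq_one_of_forall_commute hna fun g ↦ ?_
  suffices ⁅a, b⁆ ∈ centralizer {g} from (mem_centralizer_singleton_iff.mp this).symm
  rcases relIndex_centralizer_sylow hcl hp P g with h | h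
  · have hle := relIndex_eq_one.mp h
    rw [commutatorElement_def]
    exact hle (mul_mem (mul_mem (mul_mem ha hb) (inv_mem ha)) (inv_mem hb))
  · exact commutatorElement_mem_of_relIndex_eq_prime P.2 h ha hb

theorem not_sq_dvd_card (hna : ¬ ∀ a b : G, a * b = b * a)
    (hcl : ∀ x : G, (centralizer {x}).index ≤ 23) {p : ℕ} [hpf : Fact p.Prime] (hp : 5 ≤ p)
    (h11 : p = 5 → ¬ 11 ∣ Nat.card G) : ¬ p ^ 2 ∣ Nat.card G := by
  intro hsq
  obtain ⟨P⟩ : Nonempty (Sylow p G) := inferInstance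
  have hab {a b : G} (ha : a ∈ P) (hb : b ∈ P) := commute_of_mem_sylow hna hcl hp P ha hb
  have hPC : (P : Subgroup G) ≤ centralizer (P : Set G) := fun a ha b hb ↦ hab hb ha
  have hPx {x : G} (hx : x ∈ P) : (P : Subgroup G) ≤ centralizer {x} := fun a ha ↦
    mem_centralizer_singleton_iff.mpr (hab ha hx)
  have hidx {H : Subgroup G} (hH : H ≠ ⊤) : 2 * p ≤ H.index :=
    two_mul_le_of_sq_dvd_factorial hpf.out (by omega)
      ((hsq.trans (dvd_mul_left _ 2)).trans (two_mul_card_dvd_factorial_index hna hH))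
  have hcop {x y : G} (hx : x ∈ P) (hx1 : x ≠ 1) (hxy : Commute x y)
      (hc : (orderOf x).Coprime (orderOf y)) : centralizer {x} ≤ centralizer {y} := by
    refine le_trans ?_ (centralizer_mul_le_right hxy hc)
    rw [← relIndex_eq_one]
    have h1 := relIndex_mul_index (centralizer_mul_le_left hxy hc)
    have h2 := hcl (x * y)
    have h3 := hidx (centralizer_singleton_ne_top hna hx1)
    have h4 : ¬ p ∣ (centralizer {x}).index := fun h ↦
      P.not_dvd_index (h.trans (index_dvd_of_le (hPx hx)))
    have h5 : p = 5 → ¬ 11 ∣ (centralizer {x}).index := fun h h' ↦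
      h11 h (h'.trans (index_dvd_card _))
    have h6 : (centralizer {x * y}).relIndex (centralizer {x}) ≠ 0 := fun h ↦ by
      rw [h, zero_mul] at h1
      exact index_ne_zero_of_finite h1.symm
    by_contra h7
    rw [← h1] at h2
    have h8 : (centralizer {x}).index ≤ 11 := by
      have : 2 ≤ (centralizer {x * y}).relIndex (centralizer {x}) := by omega
      nlinarith
    have h9 : p = 5 := by omega
    subst h9
    have h10 := h5 rfl
    have : (centralizer {x}).index = 10 ∨ (centralizer {x}).index = 11 := by omega
    rcases this with h | h <;> rw [h] at h4 h10 <;> omega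
  have hle {x : G} (hx : x ∈ P) (hx1 : x ≠ 1) : centralizer {x} ≤ centralizer (P : Set G) := by
    rw [← relIndex_eq_one, Nat.eq_one_iff_not_exists_prime_dvd]
    intro q hq hdvd
    have := Fact.mk hq
    by_cases hqp : q = p
    · subst hqp
      exact P.not_dvd_index
        ((hdvd.trans (relIndex_dvd_of_le_left _ hPC)).trans (relIndex_dvd_index_of_le (hPx hx)))
    · obtain ⟨Q⟩ : Nonempty (Sylow q (centralizer {x})) := inferInstance
      refine Q.not_dvd_index (hdvd.trans (index_dvd_of_le fun y hy ↦ ?_))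
      obtain ⟨k, hk⟩ := (IsPGroup.iff_orderOf.mp Q.2) ⟨y, hy⟩
      obtain ⟨j, hj⟩ := (IsPGroup.iff_orderOf.mp P.2) ⟨x, hx⟩
      rw [orderOf_mk] at hj hk
      have hxy : Commute x (y : G) := (mem_centralizer_singleton_iff.mp y.2).symm
      have hc := hcop (y := y) hx hx1 hxy (by
        rw [orderOf_coe, hj, hk]
        exact Nat.coprime_pow_primes _ _ hpf.out hq (Ne.symm hqp))
      exact fun g hg ↦ mem_centralizer_singleton_iff.mp (hc (hPx hx hg))
  have hall (g : G) : g ∈ centralizer (P : Set G) := by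
    have : ∃ w ∈ P, w ∈ centralizer {g} ∧ w ≠ 1 := by
      by_contra! h
      have hbot : centralizer {g} ⊓ (P : Subgroup G) = ⊥ := by
        rw [eq_bot_iff]
        exact fun w hw ↦ h w hw.2 hw.1
      have h1 := relIndex_centralizer_sylow hcl hp P g
      rw [← inf_relIndex_right, hbot, relIndex_bot_left] at h1
      have h2 : p ^ 2 ≤ Nat.card P :=
        Nat.le_of_dvd Nat.card_pos (P.pow_dvd_card_of_pow_dvd_card hsq)
      rcases h1 with h1 | h1 <;> nlinarith
    obtain ⟨w, hwP, hwg, hw1⟩ := this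
    exact hle hwP hw1
      (mem_centralizer_singleton_iff.mpr (mem_centralizer_singleton_iff.mp hwg).symm)
  refine P.ne_bot_of_dvd_card ((dvd_pow_self p two_ne_zero).trans hsq)
    (eq_bot_iff.mpr fun x hx ↦ ?_)
  exact eq_one_of_forall_commute hna fun g ↦ (hall g x hx).symm

end SmallClasses

section SylowPrimeOrder

variable {G : Type*} [Group G] [Finite G]

theorem card_sylow_of_sq_not_dvd {p : ℕ} [hpf : Fact p.Prime] (hp : p ∣ Nat.card G)
    (hsq : ¬ p ^ 2 ∣ Nat.card G) (P : Sylow p G) : Nat.card P = p := by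
  obtain ⟨k, hk⟩ := P.2.exists_card_eq
  have h1 : p ∣ Nat.card P := P.dvd_card_of_dvd_card hp
  have h2 : ¬ 2 ≤ k := fun h ↦ hsq <| (pow_dvd_pow p h).trans <| hk ▸ card_subgroup_dvd_card _
  have h3 : k ≠ 0 := by
    rintro rfl
    rw [hk, pow_zero, Nat.dvd_one] at h1
    exact hpf.out.one_lt.ne' h1
  rw [hk, show k = 1 by omega, pow_one]

theorem exists_smul_eq_of_card_sylow {p : ℕ} [hpf : Fact p.Prime] {P Q : Sylow p G}
    (hP : Nat.card P = p) (hn : Nat.card (Sylow p G) = p + 1) (hQ : Q ≠ P) (R : Sylow p G)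
    (hR : R ≠ P) : ∃ g ∈ P, g • Q = R := by
  have hdis : (P : Subgroup G) ⊓ Q = ⊥ := by
    have hd : Nat.card ((P : Subgroup G) ⊓ Q : Subgroup G) ∣ p :=
      (card_dvd_of_le inf_le_left).trans hP.dvd
    rcases (Nat.dvd_prime hpf.out).mp hd with h | h
    · exact card_eq_one.mp h
    · have hPQ : (P : Subgroup G) ⊓ Q = P := eq_of_le_of_card_ge inf_le_left (by rw [h, hP])
      exact absurd (Sylow.ext (P.3 Q.2 (inf_eq_left.mp hPQ))) hQ
  let f : P → {R : Sylow p G // R ≠ P} := fun g ↦ ⟨(g : G) • Q, fun h ↦ hQ <| by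
    rw [← eq_inv_smul_iff] at h
    rw [h, Sylow.smul_eq_iff_mem_normalizer]
    exact le_normalizer ((P : Subgroup G).inv_mem g.2)⟩
  have hf : Function.Injective f := fun a b hab ↦ by
    have h1 : (a : G) • Q = (b : G) • Q := congrArg Subtype.val hab
    rw [← inv_smul_eq_iff, ← mul_smul, Sylow.smul_eq_iff_mem_normalizer] at h1
    have h2 : (b : G)⁻¹ * a ∈ (P : Subgroup G) ⊓ normalizer (Q : Set G) :=
      ⟨(P : Subgroup G).mul_mem ((P : Subgroup G).inv_mem b.2) a.2, h1⟩
    rw [P.2.inf_normalizer_sylow, hdis, mem_bot, inv_mul_eq_one] at h2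
    exact Subtype.ext h2.symm
  have hcard : Nat.card {R : Sylow p G // R ≠ P} ≤ Nat.card P := by
    have := Finite.card_subtype_lt (p := fun R ↦ R ≠ P) (x := P) (by simp)
    omega
  obtain ⟨g, hg⟩ := (hf.bijective_of_nat_card_le hcard).2 ⟨R, hR⟩
  exact ⟨g, g.2, congrArg Subtype.val hg⟩

theorem relIndex_centralizer_normalizer_dvd {p : ℕ} [hpf : Fact p.Prime] {P : Subgroup G}
    (hP : Nat.card P = p) :
    (centralizer (P : Set G)).relIndex (normalizer (P : Set G)) ∣ p - 1 := by
  have := isCyclic_of_prime_card hP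
  have key := card_dvd_of_injective _ (QuotientGroup.kerLift_injective P.normalizerMonoidHom)
  rwa [normalizerMonoidHom_ker, ← index, ← relIndex, IsCyclic.card_mulAut, hP,
    Nat.totient_prime hpf.out] at key

variable [IsSimpleGroup G]

theorem card_centralizer_sylow_le {p : ℕ} [hpf : Fact p.Prime] {P : Sylow p G}
    (hP : Nat.card P = p) (hn : Nat.card (Sylow p G) = p + 1) :
    Nat.card (centralizer (P : Set G)) ≤ p := by
  have hnt : Nontrivial (Sylow p G) :=
    Finite.one_lt_card_iff_nontrivial.mp (by have := hpf.out.pos; omega)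
  obtain ⟨Q, hQ⟩ := exists_ne P
  have hfixP {c : G} (hc : c ∈ centralizer (P : Set G)) : c • P = P :=
    Sylow.smul_eq_iff_mem_normalizer.mpr (centralizer_le_normalizer _ hc)
  have hker : (MulAction.toPermHom G (Sylow p G)).ker = ⊥ := by
    refine (IsSimpleGroup.eq_bot_or_eq_top_of_normal _ inferInstance).resolve_right fun h ↦ hQ ?_
    obtain ⟨g, hg⟩ := MulAction.exists_smul_eq G P Q
    have : g ∈ (MulAction.toPermHom G (Sylow p G)).ker := h ▸ mem_top g
    exact hg ▸ congrArg (fun σ ↦ σ P) (MonoidHom.mem_ker.mp this)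
  have hone {c : G} (hc : c ∈ centralizer (P : Set G)) (hcQ : c • Q = Q) : c = 1 := by
    rw [← mem_bot, ← hker, MonoidHom.mem_ker]
    ext1 R
    change c • R = R
    by_cases hR : R = P
    · rw [hR, hfixP hc]
    · obtain ⟨g, hg, rfl⟩ := exists_smul_eq_of_card_sylow hP hn hQ R hR
      rw [← mul_smul, ← hc g hg, mul_smul, hcQ]
  let f : centralizer (P : Set G) → {R : Sylow p G // R ≠ P} := fun c ↦
    ⟨(c : G) • Q, fun h ↦ hQ <| by
      rw [← eq_inv_smul_iff] at h
      rw [h, hfixP (inv_mem c.2)]⟩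
  have hf : Function.Injective f := fun a b hab ↦ by
    have h1 : (a : G) • Q = (b : G) • Q := congrArg Subtype.val hab
    rw [← inv_smul_eq_iff, ← mul_smul] at h1
    have := hone (mul_mem (inv_mem b.2) a.2) h1
    exact Subtype.ext (inv_mul_eq_one.mp this).symm
  have := Finite.card_subtype_lt (p := fun R ↦ R ≠ P) (x := P) (by simp)
  have := Nat.card_le_card_of_injective f hf
  omega

theorem normalizer_sylow_ne_top (hna : ¬ ∀ a b : G, a * b = b * a) {p : ℕ} [Fact p.Prime]
    (hp : p ∣ Nat.card G) (P : Sylow p G) : normalizer (P : Set G) ≠ ⊤ := fun h ↦ by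
  have hn : (P : Subgroup G).Normal := normalizer_eq_top_iff.mp h
  rcases IsSimpleGroup.eq_bot_or_eq_top_of_normal (P : Subgroup G) hn with h | h
  · exact P.ne_bot_of_dvd_card hp h
  · exact not_isPGroup_of_noncomm hna p (IsPGroup.of_equiv (h ▸ P.2) topEquiv)

theorem exists_sylow_count (hna : ¬ ∀ a b : G, a * b = b * a)
    (hcl : ∀ x : G, (centralizer {x}).index ≤ 23) {p : ℕ} [hpf : Fact p.Prime]
    (hp : p ∣ Nat.card G) (hsq : ¬ p ^ 2 ∣ Nat.card G) :
    ∃ n e : ℕ, n * e ≤ 23 ∧ 2 ≤ e ∧ e ∣ p - 1 ∧ n % p = 1 ∧ p < n ∧ n ∣ Nat.card G ∧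
      (n = p + 1 → Nat.card G = n * e * p) := by
  obtain ⟨P⟩ : Nonempty (Sylow p G) := inferInstance
  have hP := card_sylow_of_sq_not_dvd hp hsq P
  have hle : centralizer (P : Set G) ≤ normalizer (P : Set G) := centralizer_le_normalizer _
  have hmul : Nat.card (Sylow p G) * (centralizer (P : Set G)).relIndex (normalizer (P : Set G)) =
      (centralizer (P : Set G)).index := by
    rw [mul_comm, P.card_eq_index_normalizer]
    exact relIndex_mul_index hle
  have hPC : (P : Subgroup G) ≤ centralizer (P : Set G) := by
    have := isCyclic_of_prime_card hP
    intro a ha b hb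
    exact congrArg Subtype.val (IsCyclic.isMulCommutative.is_comm.comm (⟨b, hb⟩ : P) ⟨a, ha⟩)
  have hmod : Nat.card (Sylow p G) % p = 1 := by
    have := card_sylow_modEq_one p G
    rwa [Nat.ModEq, Nat.mod_eq_of_lt hpf.out.one_lt] at this
  have hn1 : Nat.card (Sylow p G) ≠ 1 := fun h ↦ by
    rw [P.card_eq_index_normalizer, index_eq_one] at h
    exact normalizer_sylow_ne_top hna hp P h
  have hlt : p < Nat.card (Sylow p G) := by
    by_contra! h
    rcases h.lt_or_eq with h | h
    · exact hn1 (by rwa [Nat.mod_eq_of_lt h] at hmod)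
    · rw [h, Nat.mod_self] at hmod
      omega
  refine ⟨Nat.card (Sylow p G), (centralizer (P : Set G)).relIndex (normalizer (P : Set G)),
    hmul.trans_le ?_, ?_, relIndex_centralizer_normalizer_dvd hP, hmod,
    hlt, ?_, fun hn ↦ ?_⟩
  · have := isCyclic_of_prime_card hP
    obtain ⟨x, hx⟩ := isCyclic_iff_exists_zpowers_eq_top.mp this
    refine le_trans (Nat.le_of_dvd (Nat.pos_of_ne_zero index_ne_zero_of_finite)
      (index_dvd_of_le fun g hg ↦ ?_)) (hcl x)
    rw [mem_centralizer_singleton_iff] at hg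
    intro y hy
    obtain ⟨k, hk⟩ := mem_zpowers_iff.mp (hx ▸ mem_top (⟨y, hy⟩ : P))
    have hk' : (x : G) ^ k = y := congrArg Subtype.val hk
    exact (hk' ▸ (Commute.zpow_right hg k) : Commute g y).symm
  · by_contra! h
    have h0 : (centralizer (P : Set G)).relIndex (normalizer (P : Set G)) ≠ 0 := fun h ↦ by
      rw [h, mul_zero] at hmul
      exact index_ne_zero_of_finite hmul.symm
    exact not_normalizer_le_centralizer hna hp P (relIndex_eq_one.mp (by omega))
  · rw [P.card_eq_index_normalizer]
    exact index_dvd_card _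
  · have h1 := card_centralizer_sylow_le hP hn
    have h2 := card_le_of_le hPC
    rw [hmul, ← index_mul_card (centralizer (P : Set G)), show Nat.card _ = p by omega]

theorem not_dvd_card_of_eleven_le (hna : ¬ ∀ a b : G, a * b = b * a)
    (hcl : ∀ x : G, (centralizer {x}).index ≤ 23) {p : ℕ} [Fact p.Prime] (hp : 11 ≤ p) :
    ¬ p ∣ Nat.card G := fun h ↦ by
  obtain ⟨n, e, h1, h2, -, -, h3, -⟩ :=
    exists_sylow_count hna hcl h (not_sq_dvd_card hna hcl (by omega) (by omega))
  nlinarith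

theorem not_seven_dvd_card (hna : ¬ ∀ a b : G, a * b = b * a)
    (hcl : ∀ x : G, (centralizer {x}).index ≤ 23) : ¬ 7 ∣ Nat.card G := fun h ↦ by
  have : Fact (Nat.Prime 7) := ⟨by norm_num⟩
  obtain ⟨n, e, h1, h2, -, h3, h4, -, h5⟩ :=
    exists_sylow_count hna hcl h (not_sq_dvd_card hna hcl (by omega) (by omega))
  have hn : n = 8 := by
    have : n < 12 := by nlinarith
    omega
  subst hn
  have he : e = 2 := by omega
  subst he
  have hc := h5 rfl
  norm_num at hc
  have : Fact (Nat.Prime 2) := ⟨Nat.prime_two⟩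
  obtain ⟨H, hH⟩ := Sylow.exists_subgroup_card_pow_prime (G := G) 2 (n := 4) (by rw [hc]; norm_num)
  have hi := H.card_mul_index
  rw [hH, hc] at hi
  have hi : H.index = 7 := by omega
  have hd := two_mul_card_dvd_factorial_index hna (H := H) fun h ↦ by simp [h] at hi
  rw [hi, hc] at hd
  revert hd
  decide

theorem card_eq_sixty_of_five_dvd (hna : ¬ ∀ a b : G, a * b = b * a)
    (hcl : ∀ x : G, (centralizer {x}).index ≤ 23) (h : 5 ∣ Nat.card G) : Nat.card G = 60 := by
  have : Fact (Nat.Prime 5) := ⟨by norm_num⟩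
  have : Fact (Nat.Prime 11) := ⟨by norm_num⟩
  have h11 := not_dvd_card_of_eleven_le hna hcl (le_refl 11)
  obtain ⟨n, e, h1, h2, h3, h4, h5, h6, h7⟩ :=
    exists_sylow_count hna hcl h (not_sq_dvd_card hna hcl le_rfl fun _ ↦ h11)
  have hn : n < 12 := by nlinarith
  have hn' : n = 6 := by
    have : n ≠ 11 := fun h ↦ h11 (h ▸ h6)
    omega
  subst hn'
  have he : e < 4 := by omega
  have he2 : e = 2 := by
    interval_cases e
    · rfl
    · revert h3; decide
  subst he2
  exact h7 rfl

theorem nonempty_mulEquiv_alternatingGroup_five (hna : ¬ ∀ a b : G, a * b = b * a)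
    (hc : Nat.card G = 60) : Nonempty (G ≃* alternatingGroup (Fin 5)) := by
  have : Fact (Nat.Prime 2) := ⟨Nat.prime_two⟩
  obtain ⟨P⟩ : Nonempty (Sylow 2 G) := inferInstance
  have h2 : 2 ∣ Nat.card G := by rw [hc]; norm_num
  have hP : Nat.card P = 4 := by
    have h4 : 2 ^ 2 ∣ Nat.card P := P.pow_dvd_card_of_pow_dvd_card (by rw [hc]; norm_num)
    have h60 : Nat.card P ∣ 60 := hc ▸ card_subgroup_dvd_card _
    obtain ⟨k, hk⟩ := P.2.exists_card_eq
    rw [hk] at h4 h60 ⊢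
    have h1 : 2 ≤ k := (Nat.pow_dvd_pow_iff_le_right (by norm_num)).mp h4
    have h2 : k < 3 := by
      by_contra! h
      have := (pow_dvd_pow 2 h).trans h60
      norm_num at this
    rw [show k = 2 by omega]
    norm_num
  have hle : (P : Subgroup G) ≤ normalizer (P : Set G) := le_normalizer
  have hPi : (P : Subgroup G).index = 15 := by
    have := (P : Subgroup G).card_mul_index
    rw [hc] at this
    rw [hP] at this
    omega
  have hNi : (normalizer (P : Set G)).index ∣ 15 := hPi ▸ index_dvd_of_le hle
  have hN15 : (normalizer (P : Set G)).index ≠ 15 := fun h ↦ by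
    have : normalizer (P : Set G) = P := by
      refine (eq_of_le_of_card_ge hle ?_).symm
      have := (normalizer (P : Set G)).card_mul_index
      rw [h, hc] at this
      omega
    refine not_normalizer_le_centralizer hna h2 P (this ▸ fun a ha b hb ↦ ?_)
    have := IsPGroup.isMulCommutative_of_card_eq_prime_sq (p := 2) (G := P) hP
    exact congrArg Subtype.val (this.is_comm.comm ⟨b, hb⟩ ⟨a, ha⟩)
  have hNt := normalizer_sylow_ne_top hna h2 P
  have h5 : (normalizer (P : Set G)).index = 5 := by
    have h1 := five_le_index hna hNt
    have h2 := Nat.le_of_dvd (by norm_num) hNi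
    generalize (normalizer (P : Set G)).index = k at *
    interval_cases k <;> first | rfl | omega
  have e : (G ⧸ normalizer (P : Set G)) ≃ Fin 5 := Finite.equivFinOfCardEq h5
  obtain ⟨φ, hφ⟩ := exists_injective_alternatingGroup hna (Fin 5)
    (e.permCongrHom.toMonoidHom.comp (MulAction.toPermHom G (G ⧸ normalizer (P : Set G))))
    fun h ↦ toPermHom_quotient_ne_one hNt <| by
      ext1 g
      exact e.permCongrHom.injective ((DFunLike.congr_fun h g).trans (map_one _).symm)
  have hcard : Nat.card (alternatingGroup (Fin 5)) = 60 := by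
    rw [nat_card_alternatingGroup]
    simp [Nat.factorial]
  exact ⟨MulEquiv.ofBijective φ (hφ.bijective_of_nat_card_le (by rw [hc, hcard]))⟩

end SylowPrimeOrder

section TwoThree

theorem isMulCommutative_of_card_eq_pow_le_two {H : Type*} [Group H] [Finite H] {p k : ℕ}
    [Fact p.Prime] (h : Nat.card H = p ^ k) (hk : k ≤ 2) : IsMulCommutative H := by
  interval_cases k
  · have := (Nat.card_eq_one_iff_unique.mp (by simpa using h)).1
    exact ⟨⟨fun a b ↦ Subsingleton.elim _ _⟩⟩
  · have : IsCyclic H := isCyclic_of_prime_card (by simpa using h)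
    exact IsCyclic.isMulCommutative
  · exact IsPGroup.isMulCommutative_of_card_eq_prime_sq h

variable {G : Type*} [Group G]

theorem orderOf_eq_pow_of_mem_sylow {p : ℕ} [Fact p.Prime] {P : Sylow p G} {x : G} (hx : x ∈ P) :
    ∃ i, orderOf x = p ^ i := by
  obtain ⟨i, hi⟩ := (IsPGroup.iff_orderOf.mp P.2) ⟨x, hx⟩
  exact ⟨i, by rwa [orderOf_mk] at hi⟩

variable [Finite G]

theorem exists_ne_one_sylow_le_centralizer {p : ℕ} [Fact p.Prime] (hp : p ∣ Nat.card G)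
    (P : Sylow p G) : ∃ z ∈ P, z ≠ 1 ∧ (P : Subgroup G) ≤ centralizer {z} := by
  have hnt : Nontrivial P := (nontrivial_iff_ne_bot _).mpr (P.ne_bot_of_dvd_card hp)
  have := P.2.center_nontrivial
  obtain ⟨⟨z, hz⟩, hz1⟩ := exists_ne (1 : center P)
  refine ⟨z, z.2, fun h ↦ hz1 (Subtype.ext (Subtype.ext h)), fun a ha ↦ ?_⟩
  exact mem_centralizer_singleton_iff.mpr
    (congrArg Subtype.val (mem_center_iff.mp hz ⟨a, ha⟩))

theorem exists_mul_eq_of_coprime_index {H K : Subgroup G} (h : H.index.Coprime K.index) (g : G) :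
    ∃ a ∈ H, ∃ b ∈ K, a * b = g := by
  have h1 : (H ⊓ K).relIndex H = K.relIndex H := inf_relIndex_left H K
  have h2 := relIndex_mul_index (inf_le_left : H ⊓ K ≤ H)
  have h3 : K.index ∣ K.relIndex H * H.index := by
    rw [← h1, h2]
    exact index_dvd_of_le inf_le_right
  have h4 : K.index ≤ K.relIndex H :=
    Nat.le_of_dvd (Nat.pos_of_ne_zero index_ne_zero_of_finite) (h.symm.dvd_of_dvd_mul_right h3)
  let x : G ⧸ K := (1 : G)
  have h5 : MulAction.stabilizer H x = K.subgroupOf H := by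
    ext a
    rw [MulAction.mem_stabilizer_iff, mem_subgroupOf]
    change (((a : G) * 1 : G) : G ⧸ K) = ((1 : G) : G ⧸ K) ↔ _
    rw [mul_one, QuotientGroup.eq, mul_one, inv_mem_iff]
  have h6 := MulAction.index_stabilizer H x
  rw [h5] at h6
  have h7 : MulAction.orbit H x = Set.univ :=
    Set.eq_of_subset_of_ncard_le (Set.subset_univ _)
      (by rw [Set.ncard_univ, ← h6]; exact h4) (Set.toFinite _)
  obtain ⟨a, ha⟩ := (h7 ▸ Set.mem_univ (g : G ⧸ K) : (g : G ⧸ K) ∈ MulAction.orbit H x)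
  have ha' : (((a : G) * 1 : G) : G ⧸ K) = g := ha
  rw [mul_one, QuotientGroup.eq] at ha'
  exact ⟨a, a.2, _, ha', mul_inv_cancel_left _ _⟩

variable [IsSimpleGroup G]

/-- In a nonabelian simple group, the class length of a nontrivial `p`-element is not a power
of `p`. -/
theorem index_centralizer_ne_pow (hna : ¬ ∀ a b : G, a * b = b * a) {p : ℕ} [hpf : Fact p.Prime]
    {x : G} (hx1 : x ≠ 1) {i : ℕ} (hx : orderOf x = p ^ i) (k : ℕ) :
    (centralizer {x}).index ≠ p ^ k := by
  intro hk
  have hz : IsPGroup p (zpowers x) := IsPGroup.of_card (n := i) (by rw [Nat.card_zpowers, hx])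
  obtain ⟨P, hP⟩ := hz.exists_le_sylow
  have hxP : x ∈ P := hP (mem_zpowers x)
  have hcop : (centralizer {x}).index.Coprime (P : Subgroup G).index := by
    rw [hk]
    exact Nat.Coprime.pow_left k (hpf.out.coprime_iff_not_dvd.mpr P.not_dvd_index)
  have hcore : x ∈ (P : Subgroup G).normalCore := fun g ↦ by
    obtain ⟨a, ha, b, hb, hab⟩ := exists_mul_eq_of_coprime_index hcop g⁻¹
    rw [mem_centralizer_singleton_iff] at ha
    have : g * x * g⁻¹ = b⁻¹ * x * b := by
      rw [← inv_inv g, inv_inv g⁻¹, ← hab, mul_inv_rev]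
      simp only [mul_assoc]
      rw [← mul_assoc x a b, ← ha]
      simp [mul_assoc]
    rw [this]
    exact mul_mem (mul_mem (inv_mem hb) hxP) hb
  rcases IsSimpleGroup.eq_bot_or_eq_top_of_normal (P : Subgroup G).normalCore inferInstance
    with h | h
  · exact hx1 (by rwa [h, mem_bot] at hcore)
  · have : (P : Subgroup G) = ⊤ := top_le_iff.mp (h ▸ normalCore_le _)
    exact not_isPGroup_of_noncomm hna p (IsPGroup.of_equiv (this ▸ P.2) topEquiv)

theorem not_two_dvd_card_centralizer (hna : ¬ ∀ a b : G, a * b = b * a)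
    (hcl : ∀ x : G, (centralizer {x}).index ≤ 23) {z : G} (hz1 : z ≠ 1) {i : ℕ}
    (hz : orderOf z = 3 ^ i) {k : ℕ} (hk : (centralizer {z}).index = 2 ^ k) :
    ¬ 2 ∣ Nat.card (centralizer {z}) := by
  intro h
  have : Fact (Nat.Prime 2) := ⟨Nat.prime_two⟩
  obtain ⟨⟨y, hy⟩, hy2⟩ := exists_prime_orderOf_dvd_card' 2 h
  rw [orderOf_mk] at hy2
  have hzy : Commute z y := (mem_centralizer_singleton_iff.mp hy).symm
  have hc : (orderOf z).Coprime (orderOf y) := by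
    rw [hz, hy2]
    exact Nat.Coprime.pow_left _ (by norm_num)
  have h1 := relIndex_mul_index (centralizer_mul_le_left hzy hc)
  have h2 := hcl (z * y)
  have h3 := five_le_index hna (centralizer_singleton_ne_top hna hz1)
  have h4 : 3 ≤ k := by
    by_contra! h
    rw [hk] at h3
    have := Nat.pow_le_pow_right (n := 2) two_pos (show k ≤ 2 by omega)
    omega
  have h5 : 2 ^ 3 ≤ 2 ^ k := Nat.pow_le_pow_right two_pos h4
  have h6 : (centralizer {z * y}).relIndex (centralizer {z}) ∣ 2 := by
    generalize (centralizer {z * y}).relIndex (centralizer {z}) = r at *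
    have : r ≠ 0 := by
      rintro rfl
      rw [zero_mul] at h1
      exact index_ne_zero_of_finite h1.symm
    have : r < 3 := by nlinarith
    interval_cases r <;> simp_all
  have h7 : (centralizer {y}).index ∣ 2 ^ (k + 1) := by
    refine (index_dvd_of_le (centralizer_mul_le_right hzy hc)).trans ?_
    rw [← h1, hk, pow_succ, mul_comm]
    exact mul_dvd_mul_left _ h6
  obtain ⟨j, -, hj⟩ := (Nat.dvd_prime_pow Nat.prime_two).mp h7
  refine index_centralizer_ne_pow hna (p := 2) (i := 1) ?_ (by simpa using hy2) j hj
  rintro rfl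
  simp at hy2

theorem exists_prime_dvd_ne_two_three (hna : ¬ ∀ a b : G, a * b = b * a)
    (hcl : ∀ x : G, (centralizer {x}).index ≤ 23) :
    ∃ q, q.Prime ∧ q ∣ Nat.card G ∧ q ≠ 2 ∧ q ≠ 3 := by
  by_contra! hq
  have hq' : ∀ q, q.Prime → q ∣ Nat.card G → q = 2 ∨ q = 3 := fun q h1 h2 ↦ by
    have := hq q h1 h2
    tauto
  have : Fact (Nat.Prime 2) := ⟨Nat.prime_two⟩
  have : Fact (Nat.Prime 3) := ⟨Nat.prime_three⟩
  have pow_of_not_dvd {n p r : ℕ} (hn : n ∣ Nat.card G) (hp : ¬ p ∣ n)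
      (h : ∀ q, q = 2 ∨ q = 3 → q = p ∨ q = r) : ∃ k, n = r ^ k := by
    refine ⟨_, Nat.eq_prime_pow_of_unique_prime_dvd
      (ne_zero_of_dvd_ne_zero Nat.card_pos.ne' hn) fun {d} hd hdn ↦ ?_⟩
    exact (h d (hq' d hd (hdn.trans hn))).resolve_left fun h ↦ hp (h ▸ hdn)
  have h2 : 2 ∣ Nat.card G := by
    by_contra h
    obtain ⟨k, hk⟩ := pow_of_not_dvd (r := 3) dvd_rfl h fun _ h ↦ h
    exact not_isPGroup_of_noncomm hna 3 (IsPGroup.of_card hk)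
  have h3 : 3 ∣ Nat.card G := by
    by_contra h
    obtain ⟨k, hk⟩ := pow_of_not_dvd (r := 2) dvd_rfl h fun _ h ↦ h.symm
    exact not_isPGroup_of_noncomm hna 2 (IsPGroup.of_card hk)
  have hodd (Q : Sylow 3 G) {z : G} (hz : z ∈ Q) (hz1 : z ≠ 1)
      (hQz : (Q : Subgroup G) ≤ centralizer {z}) : ¬ 2 ∣ Nat.card (centralizer {z}) := by
    obtain ⟨i, hi⟩ := orderOf_eq_pow_of_mem_sylow hz
    obtain ⟨k, hk⟩ := pow_of_not_dvd (p := 3) (r := 2) (index_dvd_card (centralizer {z}))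
      (fun h ↦ Q.not_dvd_index (h.trans (index_dvd_of_le hQz))) fun _ h ↦ h.symm
    exact not_two_dvd_card_centralizer hna hcl hz1 hi hk
  obtain ⟨P⟩ : Nonempty (Sylow 2 G) := inferInstance
  obtain ⟨z, hzP, hz1, hPz⟩ := exists_ne_one_sylow_le_centralizer h2 P
  obtain ⟨i, hi⟩ := orderOf_eq_pow_of_mem_sylow hzP
  have hiz : (centralizer {z}).index = 9 := by
    obtain ⟨k, hk⟩ := pow_of_not_dvd (p := 2) (r := 3) (index_dvd_card (centralizer {z}))
      (fun h ↦ P.not_dvd_index (h.trans (index_dvd_of_le hPz))) fun _ h ↦ h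
    have h1 := five_le_index hna (centralizer_singleton_ne_top hna hz1)
    have h2 := hcl z
    rw [hk] at h1 h2 ⊢
    have : k < 3 := (Nat.pow_lt_pow_iff_right (a := 3) (by norm_num)).mp (by omega)
    interval_cases k <;> simp at h1 ⊢
  have h27 : 27 ∣ Nat.card G := by
    obtain ⟨Q⟩ : Nonempty (Sylow 3 G) := inferInstance
    obtain ⟨w, hwQ, hw1, hQw⟩ := exists_ne_one_sylow_le_centralizer h3 Q
    obtain ⟨k, hk⟩ := pow_of_not_dvd (p := 2) (r := 3) (card_subgroup_dvd_card (centralizer {w}))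
      (hodd Q hwQ hw1 hQw) fun _ h ↦ h
    have hC : centralizer {w} = Q := Q.3 (IsPGroup.of_card hk) hQw
    have hle : (Q : Subgroup G) ≤ normalizer (Q : Set G) := le_normalizer
    obtain ⟨j, hj⟩ := pow_of_not_dvd (p := 3) (r := 2) (index_dvd_card (Q : Subgroup G))
      Q.not_dvd_index fun _ h ↦ h.symm
    have hN5 := five_le_index hna (normalizer_sylow_ne_top hna h3 Q)
    have hmod := card_sylow_modEq_one 3 G
    rw [Q.card_eq_index_normalizer] at hmod
    have h23 := hcl w
    rw [hC, hj] at h23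
    have hNQ : normalizer (Q : Set G) = Q := by
      refine le_antisymm (relIndex_eq_one.mp ?_) hle
      have hmul := relIndex_mul_index hle
      have hd : (normalizer (Q : Set G)).index ∣ 2 ^ j := hj ▸ index_dvd_of_le hle
      obtain ⟨l, hl, hl'⟩ := (Nat.dvd_prime_pow Nat.prime_two).mp hd
      rw [hl'] at hN5 hmod hmul
      rw [hj] at hmul
      have hj5 : j < 5 := (Nat.pow_lt_pow_iff_right (a := 2) (by norm_num)).mp (by omega)
      have hl4 : l = 4 := by
        have : l < 5 := by omega
        interval_cases l <;> simp [Nat.ModEq] at hN5 hmod ⊢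
      have hj4 : j = 4 := by omega
      subst hl4 hj4
      simpa using hmul
    obtain ⟨b, hb⟩ := Q.2.exists_card_eq
    have hb3 : 3 ≤ b := by
      by_contra! h
      have := isMulCommutative_of_card_eq_pow_le_two hb (by omega)
      refine not_normalizer_le_centralizer hna h3 Q (hNQ ▸ fun a ha b hb ↦ ?_)
      exact congrArg Subtype.val (this.is_comm.comm ⟨b, hb⟩ ⟨a, ha⟩)
    exact (pow_dvd_pow 3 hb3).trans (hb ▸ card_subgroup_dvd_card (Q : Subgroup G))
  have h3z : 3 ∣ Nat.card (centralizer {z}) := by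
    have := (centralizer {z}).card_mul_index
    rw [hiz] at this
    omega
  obtain ⟨⟨y, hy⟩, hy3⟩ := exists_prime_orderOf_dvd_card' 3 h3z
  rw [orderOf_mk] at hy3
  have hy1 : y ≠ 1 := by
    rintro rfl
    simp at hy3
  have hzy : Commute z y := (mem_centralizer_singleton_iff.mp hy).symm
  have hc : (orderOf z).Coprime (orderOf y) := by
    rw [hi, hy3]
    exact Nat.Coprime.pow_left _ (by norm_num)
  have hr := relIndex_mul_index (centralizer_mul_le_left hzy hc)
  have hr' := relIndex_mul_index (centralizer_mul_le_right hzy hc)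
  have hzy23 := hcl (z * y)
  have hy5 := five_le_index hna (centralizer_singleton_ne_top hna hy1)
  have hy9 : (centralizer {y}).index ≠ 9 := fun h ↦
    index_centralizer_ne_pow hna (p := 3) (i := 1) hy1 (by simpa using hy3) 2 h
  have hy6 : (centralizer {y}).index ≠ 6 := fun h ↦ by
    have hd := (mul_dvd_mul_left 2 h27).trans
      (two_mul_card_dvd_factorial_index hna (centralizer_singleton_ne_top hna hy1))
    rw [h] at hd
    revert hd
    decide
  have hle : centralizer {y} ≤ centralizer {z} := by
    refine le_trans (relIndex_eq_one.mp ?_) (centralizer_mul_le_left hzy hc)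
    rw [hiz] at hr
    have h0 : (centralizer {z * y}).index ≠ 0 := index_ne_zero_of_finite
    generalize (centralizer {z * y}).relIndex (centralizer {z}) = r at *
    generalize (centralizer {z * y}).relIndex (centralizer {y}) = s at *
    generalize (centralizer {z * y}).index = m at *
    generalize (centralizer {y}).index = n at *
    subst hr
    have hr3 : r < 3 := by omega
    have hs : s < 5 := by nlinarith
    interval_cases r <;> interval_cases s <;> omega
  obtain ⟨Q, hQ⟩ := (IsPGroup.of_card (p := 3) (n := 1)
    (by rw [Nat.card_zpowers, hy3, pow_one]) : IsPGroup 3 (zpowers y)).exists_le_sylow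
  obtain ⟨w, hwQ, hw1, hQw⟩ := exists_ne_one_sylow_le_centralizer h3 Q
  have hyw := mem_centralizer_singleton_iff.mp (hQw (hQ (mem_zpowers y)))
  have hwz := mem_centralizer_singleton_iff.mp (hle (mem_centralizer_singleton_iff.mpr hyw.symm))
  refine hodd Q hwQ hw1 hQw ?_
  have hzw : z ∈ centralizer {w} := mem_centralizer_singleton_iff.mpr hwz.symm
  have h2z : 2 ∣ orderOf z := by
    rw [hi]
    refine dvd_pow_self 2 ?_
    rintro rfl
    exact hz1 (orderOf_eq_one_iff.mp (by simpa using hi))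
  exact h2z.trans (orderOf_dvd_natCard (centralizer {w}) hzw)

/-- A finite nonabelian simple group all of whose classes have length at most `23` is `Alt(5)`. -/
theorem nonempty_mulEquiv_of_forall_index_centralizer_le (hna : ¬ ∀ a b : G, a * b = b * a)
    (hcl : ∀ x : G, (centralizer {x}).index ≤ 23) : Nonempty (G ≃* alternatingGroup (Fin 5)) := by
  obtain ⟨q, hq, hqd, hq2, hq3⟩ := exists_prime_dvd_ne_two_three hna hcl
  have := Fact.mk hq
  have hq11 : q < 11 := by
    by_contra! h
    exact not_dvd_card_of_eleven_le hna hcl h hqd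
  have hq7 : q ≠ 7 := by
    rintro rfl
    exact not_seven_dvd_card hna hcl hqd
  have hq5 : q = 5 := by
    interval_cases q <;> first | rfl | omega | exact absurd hq (by norm_num)
  subst hq5
  exact nonempty_mulEquiv_alternatingGroup_five hna (card_eq_sixty_of_five_dvd hna hcl hqd)

end TwoThree

section Product

theorem card_orbit_conjAct {G : Type*} [Group G] (g : G) :
    Nat.card (MulAction.orbit (ConjAct G) g) = (centralizer {g}).index := by
  rw [Nat.card_coe_set_eq, ← MulAction.index_stabilizer, centralizer_eq_comap_stabilizer]
  exact (index_comap_of_surjective (MulAction.stabilizer (ConjAct G) g)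
    (f := ConjAct.toConjAct.toMonoidHom) ConjAct.toConjAct.surjective).symm

theorem index_centralizer_le_mccl {G : Type*} [Group G] [Finite G] (g : G) :
    (centralizer {g}).index ≤ mccl G :=
  card_orbit_conjAct g ▸ le_ciSup (f := fun g : G ↦ Nat.card (MulAction.orbit (ConjAct G) g))
    (Set.finite_range _).bddAbove g

variable {ι : Type*} {S : ι → Type*} [∀ i, Group (S i)]

theorem index_centralizer_apply_le_mccl [Finite (∀ i, S i)] (g : ∀ i, S i) (i : ι) :
    (centralizer {g i}).index ≤ mccl (∀ i, S i) := by
  have hsurj : Function.Surjective (Pi.evalMonoidHom S i) := Function.surjective_eval i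
  rw [← index_comap_of_surjective _ hsurj]
  refine le_trans (Nat.le_of_dvd (Nat.pos_of_ne_zero index_ne_zero_of_finite)
    (index_dvd_of_le fun h hh ↦ ?_)) (index_centralizer_le_mccl g)
  rw [mem_centralizer_singleton_iff] at hh
  exact mem_centralizer_singleton_iff.mpr (congrFun hh i)

theorem index_centralizer_mul_le_mccl [Finite (∀ i, S i)] {i j : ι} (hij : i ≠ j)
    (g : ∀ i, S i) :
    (centralizer {g i}).index * (centralizer {g j}).index ≤ mccl (∀ i, S i) := by
  classical
  have hsurj : Function.Surjective ((Pi.evalMonoidHom S i).prod (Pi.evalMonoidHom S j)) := by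
    rintro ⟨a, b⟩
    refine ⟨Function.update (Function.update 1 i a) j b, ?_⟩
    simp [hij]
  rw [← index_prod, ← index_comap_of_surjective _ hsurj]
  refine le_trans (Nat.le_of_dvd (Nat.pos_of_ne_zero index_ne_zero_of_finite)
    (index_dvd_of_le fun h hh ↦ ?_)) (index_centralizer_le_mccl g)
  rw [mem_centralizer_singleton_iff] at hh
  exact ⟨mem_centralizer_singleton_iff.mpr (congrFun hh i),
    mem_centralizer_singleton_iff.mpr (congrFun hh j)⟩

end Product

theorem stmt_18 (ι : Type*) [Nonempty ι] [Finite ι] (S : ι → Type*)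
    [∀ i, Group (S i)] [∀ i, Finite (S i)]
    (hsimple : ∀ i, IsSimpleGroup (S i))
    (hna : ∀ i, ¬ ∀ a b : S i, a * b = b * a)
    (h : mccl (∀ i, S i) ≤ 23) :
    Nonempty ((∀ i, S i) ≃* alternatingGroup (Fin 5)) := by
  classical
  have hsub : Subsingleton ι := by
    refine ⟨fun i j ↦ by_contra fun hij ↦ ?_⟩
    have hne : ∀ i, ∃ x : S i, x ≠ 1 := fun i ↦ exists_ne 1
    choose g hg using hne
    have h1 := five_le_index (hna i) (centralizer_singleton_ne_top (hna i) (hg i))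
    have h2 := five_le_index (hna j) (centralizer_singleton_ne_top (hna j) (hg j))
    have h3 := index_centralizer_mul_le_mccl hij g
    nlinarith
  obtain ⟨i⟩ := ‹Nonempty ι›
  have : Unique ι := uniqueOfSubsingleton i
  obtain ⟨e⟩ := nonempty_mulEquiv_of_forall_index_centralizer_le (hna default) fun x ↦ by
    have := index_centralizer_apply_le_mccl (Pi.mulSingle default x) default
    rw [Pi.mulSingle_eq_same] at this
    exact this.trans h
  exact ⟨(MulEquiv.piUnique S).trans e⟩
end
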